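/- Assume m ≥ 2, n ≥ 2, U ⊆ ℝ^m open and connected, H(u) = H0 + u1·H1 + ⋯ + um·Hm with H0,…,Hm Hermitian n×n complex matrices, and that the spectrum of H(·) is conically connected. Then the control system i·ψ̇(t) = H(u(t))·ψ(t) on the unit sphere S^{2n−1} ⊂ ℂ^n is exactly controllable: for every ψ0 ∈ S^{2n−1}, its reachable set from ψ0 is all of S^{2n−1}. -/

import Mathlib

open scoped BigOperators

/-- The control-affine Hamiltonian `H(u) = H0 + u 1 • H1 + ⋯ + u m • Hm`. -/
noncomputable def controlHam {n m : ℕ} (H0 : Matrix (Fin n) (Fin n) ℂ)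
    (Hc : Fin m → Matrix (Fin n) (Fin n) ℂ) (u : EuclideanSpace ℝ (Fin m)) :
    Matrix (Fin n) (Fin n) ℂ :=
  H0 + ∑ i, (u i : ℂ) • Hc i

/-- `lam u 0 ≤ ⋯ ≤ lam u (n-1)` are the eigenvalues of `H(u)`, repeated according to
their multiplicities, for every `u ∈ U`:  `lam u` is monotone and the characteristic
polynomial of `H(u)` is `∏ j, (X - lam u j)`. -/
def IsOrderedSpectrum {n m : ℕ} (H0 : Matrix (Fin n) (Fin n) ℂ)
    (Hc : Fin m → Matrix (Fin n) (Fin n) ℂ) (U : Set (EuclideanSpace ℝ (Fin m)))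
    (lam : EuclideanSpace ℝ (Fin m) → Fin n → ℝ) : Prop :=
  ∀ u ∈ U, Monotone (lam u) ∧
    (controlHam H0 Hc u).charpoly = ∏ j, (Polynomial.X - Polynomial.C ((lam u j : ℂ)))

/-- The eigenvalue `lam ubar l` is a simple eigenvalue. -/
def SimpleEigAt {n m : ℕ} (lam : EuclideanSpace ℝ (Fin m) → Fin n → ℝ)
    (ubar : EuclideanSpace ℝ (Fin m)) (l : Fin n) : Prop :=
  ∀ l' : Fin n, lam ubar l' = lam ubar l → l' = l

/-- `ubar ∈ U` is a conical intersection between the (consecutive) eigenvalues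
`lam · j` and `lam · k`:  they coincide at `ubar`, the common value is an eigenvalue of
multiplicity two, and the gap opens at least linearly in every direction. -/
def ConicalAt {n m : ℕ} (U : Set (EuclideanSpace ℝ (Fin m)))
    (lam : EuclideanSpace ℝ (Fin m) → Fin n → ℝ) (j k : Fin n)
    (ubar : EuclideanSpace ℝ (Fin m)) : Prop :=
  ubar ∈ U ∧ lam ubar j = lam ubar k ∧
  (∀ l : Fin n, lam ubar l = lam ubar j ↔ (l = j ∨ l = k)) ∧
  ∃ c > (0 : ℝ), ∀ v : EuclideanSpace ℝ (Fin m), ‖v‖ = 1 →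
    ∃ ε > (0 : ℝ), ∀ t : ℝ, 0 < t → t < ε →
      lam (ubar + t • v) k - lam (ubar + t • v) j > c * t

/-- The spectrum is conically connected: every eigenvalue intersection is conical, and
every pair of subsequent eigenvalues admits a conical intersection at which all the
other eigenvalues are simple. -/
def ConicallyConnected {n m : ℕ} (U : Set (EuclideanSpace ℝ (Fin m)))
    (lam : EuclideanSpace ℝ (Fin m) → Fin n → ℝ) : Prop :=
  (∀ ubar ∈ U, ∀ j k : Fin n, (j : ℕ) + 1 = (k : ℕ) → lam ubar j = lam ubar k →
    ConicalAt U lam j k ubar) ∧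
  (∀ j k : Fin n, (j : ℕ) + 1 = (k : ℕ) → ∃ ubar : EuclideanSpace ℝ (Fin m),
    ConicalAt U lam j k ubar ∧ ∀ l : Fin n, l ≠ j → l ≠ k → SimpleEigAt lam ubar l)

attribute [local instance] Matrix.normedAddCommGroup Matrix.normedSpace

open MeasureTheory in
/-- A control `u : [0,T] → U` which is measurable and (essentially) bounded. -/
def IsAdmissibleControl {m : ℕ} (U : Set (EuclideanSpace ℝ (Fin m))) (T : ℝ)
    (u : ℝ → EuclideanSpace ℝ (Fin m)) : Prop :=
  AEStronglyMeasurable u (volume.restrict (Set.Icc 0 T)) ∧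
  (∀ t ∈ Set.Icc 0 T, u t ∈ U) ∧ ∃ C : ℝ, ∀ t ∈ Set.Icc 0 T, ‖u t‖ ≤ C

/-- An admissible trajectory of the lifted system `i·ġ(t) = H(u(t))·g(t)` on the
unitary group: an absolutely continuous curve in `U(n)` solving the equation almost
everywhere on `[0,T]`, encoded in integral form. -/
def IsLiftedTrajectory {n m : ℕ}
    (Hmat : EuclideanSpace ℝ (Fin m) → Matrix (Fin n) (Fin n) ℂ) (T : ℝ)
    (u : ℝ → EuclideanSpace ℝ (Fin m)) (g : ℝ → Matrix (Fin n) (Fin n) ℂ) : Prop :=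
  (∀ t ∈ Set.Icc 0 T, g t ∈ Matrix.unitaryGroup (Fin n) ℂ) ∧
  @IntervalIntegrable (Matrix (Fin n) (Fin n) ℂ)
    PseudoMetricSpace.toUniformSpace.toTopologicalSpace _
    (fun s => (-Complex.I) • (Hmat (u s) * g s))
    MeasureTheory.volume 0 T ∧
  ∀ t ∈ Set.Icc 0 T, g t = g 0 + ∫ s in (0:ℝ)..t, (-Complex.I) • (Hmat (u s) * g s)

/-- The reachable set from `g0` of the lifted system on the unitary group. -/
def liftedReachable {n m : ℕ} (U : Set (EuclideanSpace ℝ (Fin m)))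
    (Hmat : EuclideanSpace ℝ (Fin m) → Matrix (Fin n) (Fin n) ℂ)
    (g0 : Matrix (Fin n) (Fin n) ℂ) : Set (Matrix (Fin n) (Fin n) ℂ) :=
  {g1 | ∃ T : ℝ, 0 ≤ T ∧ ∃ u g, IsAdmissibleControl U T u ∧
    IsLiftedTrajectory Hmat T u g ∧ g 0 = g0 ∧ g T = g1}

/-- An admissible trajectory of the system `i·ψ̇(t) = H(u(t))·ψ(t)` on the unit sphere
of `ℂ^n`: an absolutely continuous curve in the sphere solving the equation almost
everywhere on `[0,T]`, encoded in integral form. -/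
def IsSphereTrajectory {n m : ℕ}
    (Hmat : EuclideanSpace ℝ (Fin m) → Matrix (Fin n) (Fin n) ℂ) (T : ℝ)
    (u : ℝ → EuclideanSpace ℝ (Fin m)) (ψ : ℝ → EuclideanSpace ℂ (Fin n)) : Prop :=
  (∀ t ∈ Set.Icc 0 T, ψ t ∈ Metric.sphere (0 : EuclideanSpace ℂ (Fin n)) 1) ∧
  IntervalIntegrable (fun s => (-Complex.I) • Matrix.toEuclideanLin (Hmat (u s)) (ψ s))
    MeasureTheory.volume 0 T ∧
  ∀ t ∈ Set.Icc 0 T,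
    ψ t = ψ 0 + ∫ s in (0:ℝ)..t, (-Complex.I) • Matrix.toEuclideanLin (Hmat (u s)) (ψ s)

/-- The reachable set from `ψ0` of the system on the unit sphere of `ℂ^n`. -/
def sphereReachable {n m : ℕ} (U : Set (EuclideanSpace ℝ (Fin m)))
    (Hmat : EuclideanSpace ℝ (Fin m) → Matrix (Fin n) (Fin n) ℂ)
    (ψ0 : EuclideanSpace ℂ (Fin n)) : Set (EuclideanSpace ℂ (Fin n)) :=
  {ψ1 | ∃ T : ℝ, 0 ≤ T ∧ ∃ u ψ, IsAdmissibleControl U T u ∧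
    IsSphereTrajectory Hmat T u ψ ∧ ψ 0 = ψ0 ∧ ψ T = ψ1}

/-! ## Part A: abstract controllability on the sphere -/

section PartA

variable {V : Type} [NormedAddCommGroup V] [InnerProductSpace ℂ V] [FiniteDimensional ℂ V]

/-- The one-parameter group generated by `X`. -/
noncomputable def cEx (t : ℝ) (X : V →L[ℂ] V) : V →L[ℂ] V := NormedSpace.exp ((t : ℂ) • X)

theorem cEx_zero (X : V →L[ℂ] V) : cEx 0 X = 1 := by
  simp [cEx, NormedSpace.exp_zero]

theorem cEx_add (s t : ℝ) (X : V →L[ℂ] V) : cEx (s + t) X = cEx s X * cEx t X := by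
  have : CompleteSpace V := FiniteDimensional.complete ℂ V
  let : NormedAlgebra ℚ (V →L[ℂ] V) := NormedAlgebra.restrictScalars ℚ ℂ _
  unfold cEx
  push_cast
  rw [add_smul, NormedSpace.exp_add_of_commute]
  exact ((Commute.refl X).smul_left _).smul_right _

theorem cEx_mul_neg (t : ℝ) (X : V →L[ℂ] V) : cEx t X * cEx (-t) X = 1 := by
  rw [← cEx_add, add_neg_cancel, cEx_zero]

theorem cEx_neg_mul (t : ℝ) (X : V →L[ℂ] V) : cEx (-t) X * cEx t X = 1 := by
  rw [← cEx_add, neg_add_cancel, cEx_zero]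

theorem cEx_neg_apply (t : ℝ) (X : V →L[ℂ] V) (x : V) : cEx (-t) X (cEx t X x) = x := by
  rw [← mul_apply_eq_comp, cEx_neg_mul, one_apply_eq_self]

theorem cEx_apply_neg (t : ℝ) (X : V →L[ℂ] V) (x : V) : cEx t X (cEx (-t) X x) = x := by
  rw [← mul_apply_eq_comp, cEx_mul_neg, one_apply_eq_self]

theorem cEx_neg_op (t : ℝ) (X : V →L[ℂ] V) : cEx t (-X) = cEx (-t) X := by
  unfold cEx; simp

theorem cEx_strict (t : ℝ) (X : V →L[ℂ] V) :
    HasStrictDerivAt (fun s : ℝ => cEx s X) (X * cEx t X) t := by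
  have : CompleteSpace V := FiniteDimensional.complete ℂ V
  have h := hasStrictDerivAt_exp_smul_const' (𝕂 := ℝ) X t
  unfold cEx
  simpa [Complex.coe_smul] using h

theorem cEx_commute (t : ℝ) (X : V →L[ℂ] V) : X * cEx t X = cEx t X * X := by
  have : CompleteSpace V := FiniteDimensional.complete ℂ V
  have h := hasStrictDerivAt_exp_smul_const (𝕂 := ℝ) X t
  have h2 := cEx_strict t X
  unfold cEx at *
  simp only [Complex.coe_smul] at *
  exact h2.hasDerivAt.unique h.hasDerivAt

/-- skew-adjointness -/
def IsSkew (X : V →L[ℂ] V) : Prop := ∀ x y, inner ℂ (X x) y = - inner ℂ x (X y)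

theorem cEx_apply_hasDerivAt (t : ℝ) (X : V →L[ℂ] V) (x : V) :
    HasDerivAt (fun s : ℝ => cEx s X x) (X (cEx t X x)) t := by
  have h := (cEx_strict t X).hasDerivAt
  have h2 := ((ContinuousLinearMap.apply ℂ V x).restrictScalars ℝ).hasFDerivAt.comp_hasDerivAt t h
  exact h2

theorem cEx_inner {X : V →L[ℂ] V} (hX : IsSkew X) (t : ℝ) (x y : V) :
    inner ℂ (cEx t X x) (cEx t X y) = inner ℂ x y := by
  have hd : ∀ s : ℝ, HasDerivAt (fun s : ℝ => inner ℂ (cEx s X x) (cEx s X y)) 0 s := by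
    intro s
    have h := (cEx_apply_hasDerivAt s X x).inner ℂ (cEx_apply_hasDerivAt s X y)
    have h0 : inner ℂ (cEx s X x) (X (cEx s X y)) + inner ℂ (X (cEx s X x)) (cEx s X y) = 0 := by
      rw [hX]; simp
    rw [h0] at h
    exact h
  have h1 := is_const_of_deriv_eq_zero (fun s => (hd s).differentiableAt) (fun s => (hd s).deriv) t 0
  simpa [cEx_zero] using h1

theorem cEx_norm {X : V →L[ℂ] V} (hX : IsSkew X) (t : ℝ) (x : V) : ‖cEx t X x‖ = ‖x‖ := by
  have h := cEx_inner hX t x x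
  rw [inner_self_eq_norm_sq_to_K, inner_self_eq_norm_sq_to_K] at h
  have h2 : ‖cEx t X x‖ ^ 2 = ‖x‖ ^ 2 := by exact_mod_cast h
  exact (sq_eq_sq₀ (norm_nonneg _) (norm_nonneg _)).1 h2

/-- forward orbit by positive times -/
inductive COrb (S : Set (V →L[ℂ] V)) : V → V → Prop
  | refl (x : V) : COrb S x x
  | step {x y : V} (X : V →L[ℂ] V) (t : ℝ) (hX : X ∈ S) (ht : 0 < t) (h : COrb S x y) :
      COrb S x (cEx t X y)

theorem COrb.trans {S : Set (V →L[ℂ] V)} {x y z : V} (h1 : COrb S x y) (h2 : COrb S y z) :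
    COrb S x z := by
  induction h2 with
  | refl => exact h1
  | step X t hX ht _ ih => exact COrb.step X t hX ht ih

theorem COrb.symm_neg {S : Set (V →L[ℂ] V)} {x y : V}
    (h : COrb {X | -X ∈ S} x y) : COrb S y x := by
  induction h with
  | refl => exact COrb.refl _
  | @step y X t hX ht _ ih =>
    refine COrb.trans ?_ ih
    have : y = cEx t (-X) (cEx t X y) := by
      rw [cEx_neg_op, cEx_neg_apply]
    nth_rewrite 2 [this]
    exact COrb.step (-X) t hX ht (COrb.refl _)

theorem COrb.norm_eq {S : Set (V →L[ℂ] V)} (hS : ∀ X ∈ S, IsSkew X) {x y : V}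
    (h : COrb S x y) : ‖y‖ = ‖x‖ := by
  induction h with
  | refl => rfl
  | step X t hX ht _ ih => rw [cEx_norm (hS X hX), ih]

/-- `p` is the endpoint of a smooth family of endpoints with tangent space `K`. -/
def CAttain (S : Set (V →L[ℂ] V)) (x p : V) (K : Submodule ℝ V) : Prop :=
  ∃ (D : Type) (_ : NormedAddCommGroup D) (_ : NormedSpace ℝ D) (_ : CompleteSpace D)
    (F : D → V) (F' : D →L[ℝ] V) (t0 : D), HasStrictFDerivAt F F' t0 ∧ F t0 = p ∧
    (∀ᶠ t in nhds t0, COrb S x (F t)) ∧ (F' : D →ₗ[ℝ] V).range = K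

theorem CAttain.base (S : Set (V →L[ℂ] V)) (x : V) : CAttain S x x ⊥ := by
  refine ⟨PUnit, inferInstance, inferInstance, inferInstance, fun _ => x, 0, PUnit.unit,
    hasStrictFDerivAt_const _ _, rfl, Filter.Eventually.of_forall fun _ => COrb.refl x, ?_⟩
  simp

theorem CAttain.step {S : Set (V →L[ℂ] V)} {x p : V} {K : Submodule ℝ V}
    (h : CAttain S x p K) {X : V →L[ℂ] V} (hX : X ∈ S) {τ : ℝ} (hτ : 0 < τ) :
    CAttain S x (cEx τ X p)
      ((K ⊔ Submodule.span ℝ {X p}).map ((cEx τ X).restrictScalars ℝ : V →ₗ[ℝ] V)) := by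
  obtain ⟨D, i1, i2, i3, F, F', t0, hF, hp, hev, hr⟩ := h
  refine ⟨D × ℝ, inferInstance, inferInstance, inferInstance, fun q => cEx q.2 X (F q.1),
    (((cEx τ X).restrictScalars ℝ).comp F').comp (ContinuousLinearMap.fst ℝ D ℝ) +
      (ContinuousLinearMap.snd ℝ D ℝ).smulRight (X (cEx τ X p)), (t0, τ), ?_, by simp [hp], ?_, ?_⟩
  · have h1 : HasStrictFDerivAt (fun q : D × ℝ => cEx q.2 X)
        ((ContinuousLinearMap.smulRight (1 : ℝ →L[ℝ] ℝ) (X * cEx τ X)).comp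
          (ContinuousLinearMap.snd ℝ D ℝ)) (t0, τ) :=
      HasStrictFDerivAt.comp (g := fun s : ℝ => cEx s X) (f := Prod.snd) (t0, τ)
        (cEx_strict τ X).hasStrictFDerivAt hasStrictFDerivAt_snd
    have h2 : HasStrictFDerivAt (fun q : D × ℝ => F q.1)
        (F'.comp (ContinuousLinearMap.fst ℝ D ℝ)) (t0, τ) :=
      HasStrictFDerivAt.comp (t0, τ) hF hasStrictFDerivAt_fst
    let B : (V →L[ℂ] V) →L[ℝ] V →L[ℝ] V :=
      ContinuousLinearMap.restrictScalarsL ℂ V V ℝ ℝ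
    have h3 : HasStrictFDerivAt (fun q : D × ℝ => B (cEx q.2 X)) _ (t0, τ) :=
      (B.hasStrictFDerivAt).comp (t0, τ) h1
    have h4 := h3.clm_apply h2
    refine h4.congr_fderiv ?_
    ext q
    · simp [B]
    · simp [B, hp]
  · have a1 : ∀ᶠ q : D × ℝ in nhds (t0, τ), COrb S x (F q.1) :=
      (continuous_fst.tendsto (t0, τ)).eventually hev
    have a2 : ∀ᶠ q : D × ℝ in nhds (t0, τ), 0 < q.2 :=
      (continuous_snd.tendsto (t0, τ)).eventually (lt_mem_nhds hτ)
    filter_upwards [a1, a2] with q h1 h2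
    exact COrb.step X _ hX h2 h1
  · subst hr
    ext z
    simp only [LinearMap.mem_range, Submodule.mem_map, Submodule.mem_sup,
      Submodule.mem_span_singleton]
    have hc : X (cEx τ X p) = cEx τ X (X p) := by
      have := cEx_commute τ X
      exact congrArg (fun A : V →L[ℂ] V => A p) this
    constructor
    · rintro ⟨⟨d, s⟩, rfl⟩
      refine ⟨F' d + s • X p, ⟨F' d, ⟨d, rfl⟩, s • X p, ⟨s, rfl⟩, rfl⟩, ?_⟩
      simp [hc]
    · rintro ⟨_, ⟨_, ⟨d, rfl⟩, _, ⟨s, rfl⟩, rfl⟩, rfl⟩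
      refine ⟨(d, s), ?_⟩
      simp [hc]

theorem CAttain.orb {S : Set (V →L[ℂ] V)} {x p : V} {K : Submodule ℝ V}
    (h : CAttain S x p K) : COrb S x p := by
  obtain ⟨D, i1, i2, i3, F, F', t0, hF, hp, hev, hr⟩ := h
  exact hp ▸ hev.self_of_nhds

/-- maximal attained tangent space -/
theorem CAttain.exists_max (S : Set (V →L[ℂ] V)) (x : V) :
    ∃ p K, CAttain S x p K ∧ ∀ p' K', CAttain S x p' K' →
      Module.finrank ℝ K' ≤ Module.finrank ℝ K := by
  have : FiniteDimensional ℝ V := FiniteDimensional.complexToReal V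
  let P : ℕ → Prop := fun k => ∃ p K, CAttain S x p K ∧ Module.finrank ℝ K = k
  have hb : ∀ k, P k → k ≤ Module.finrank ℝ V := by
    rintro k ⟨p, K, _, rfl⟩
    exact Submodule.finrank_le K
  classical
  have h0 : P (Module.finrank ℝ (⊥ : Submodule ℝ V)) := ⟨x, ⊥, CAttain.base S x, rfl⟩
  have hs := Nat.findGreatest_spec (P := P) (hb _ h0) h0
  obtain ⟨p, K, hK, hk⟩ := hs
  refine ⟨p, K, hK, fun p' K' h' => ?_⟩
  rw [hk]
  exact Nat.le_findGreatest (hb _ ⟨p', K', h', rfl⟩) ⟨p', K', h', rfl⟩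

theorem hasDerivAt_mem_submodule {W : Type} [NormedAddCommGroup W] [NormedSpace ℝ W]
    [FiniteDimensional ℝ W] (K : Submodule ℝ W) {f : ℝ → W} {f' : W} {a : ℝ}
    (hf : HasDerivAt f f' a) (hm : ∀ t, f t ∈ K) : f' ∈ K := by
  have hc : IsClosed (K : Set W) := K.closed_of_finiteDimensional
  rw [hasDerivAt_iff_tendsto_slope] at hf
  refine hc.mem_of_tendsto hf (Filter.Eventually.of_forall fun t => ?_)
  exact K.smul_mem _ (K.sub_mem (hm _) (hm _))

theorem finrank_map_inj {W : Type} [AddCommGroup W] [Module ℝ W] (f : W →ₗ[ℝ] W)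
    (hf : Function.Injective f) (K : Submodule ℝ W) :
    Module.finrank ℝ (K.map f) = Module.finrank ℝ K :=
  (Submodule.equivMapOfInjective f hf K).finrank_eq.symm

theorem finDim_op_real : FiniteDimensional ℝ (V →L[ℂ] V) := by
  have : FiniteDimensional ℂ (V →L[ℂ] V) := inferInstance
  exact FiniteDimensional.complexToReal _

/-- conjugates of the generators by inverses of elements of the semigroup -/
inductive CConj (S : Set (V →L[ℂ] V)) : (V →L[ℂ] V) → Prop
  | base (Y : V →L[ℂ] V) (hY : Y ∈ S) : CConj S Y
  | step (A X : V →L[ℂ] V) (t : ℝ) (hX : X ∈ S) (ht : 0 < t) (h : CConj S A) :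
      CConj S (cEx (-t) X * A * cEx t X)

/-- the real span of the conjugates -/
noncomputable def CAlg (S : Set (V →L[ℂ] V)) : Submodule ℝ (V →L[ℂ] V) :=
  Submodule.span ℝ {A | CConj S A}

/-- conjugation as a real linear map -/
noncomputable def conjLin (g h : V →L[ℂ] V) : (V →L[ℂ] V) →ₗ[ℝ] (V →L[ℂ] V) where
  toFun A := g * A * h
  map_add' A B := by rw [mul_add, add_mul]
  map_smul' c A := by simp

theorem CAlg_conj_pos {S : Set (V →L[ℂ] V)} {X : V →L[ℂ] V} (hX : X ∈ S) {t : ℝ} (ht : 0 < t) :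
    (CAlg S).map (conjLin (cEx (-t) X) (cEx t X)) = CAlg S := by
  have := finDim_op_real (V := V)
  apply Submodule.eq_of_le_of_finrank_eq
  · unfold CAlg
    rw [Submodule.map_span, Submodule.span_le]
    rintro _ ⟨A, hA, rfl⟩
    exact Submodule.subset_span (CConj.step A X t hX ht hA)
  · apply finrank_map_inj
    intro A B hAB
    have h : cEx (-t) X * A * cEx t X = cEx (-t) X * B * cEx t X := hAB
    have h2 : ∀ C : V →L[ℂ] V, cEx t X * (cEx (-t) X * C * cEx t X) * cEx (-t) X = C := by
      intro C
      rw [← mul_assoc, ← mul_assoc, cEx_mul_neg, one_mul, mul_assoc, cEx_mul_neg, mul_one]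
    rw [← h2 A, h, h2]

theorem CAlg_conj {S : Set (V →L[ℂ] V)} {X : V →L[ℂ] V} (hX : X ∈ S) (t : ℝ)
    {A : V →L[ℂ] V} (hA : A ∈ CAlg S) : cEx t X * A * cEx (-t) X ∈ CAlg S := by
  rcases lt_trichotomy t 0 with h | h | h
  · have := CAlg_conj_pos hX (t := -t) (by linarith)
    rw [← this]
    refine ⟨A, hA, ?_⟩
    simp [conjLin]
  · subst h; simpa [cEx_zero] using hA
  · rw [← CAlg_conj_pos hX h] at hA
    obtain ⟨B, hB, rfl⟩ := hA
    have : cEx t X * (cEx (-t) X * B * cEx t X) * cEx (-t) X = B := by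
      rw [← mul_assoc, ← mul_assoc, cEx_mul_neg, one_mul, mul_assoc, cEx_mul_neg, mul_one]
    change cEx t X * (cEx (-t) X * B * cEx t X) * cEx (-t) X ∈ _
    rw [this]; exact hB

theorem CAlg_bracket_base {S : Set (V →L[ℂ] V)} {X : V →L[ℂ] V} (hX : X ∈ S)
    {A : V →L[ℂ] V} (hA : A ∈ CAlg S) : X * A - A * X ∈ CAlg S := by
  have := finDim_op_real (V := V)
  have h1 := (cEx_strict 0 X).hasDerivAt
  have h2 : HasDerivAt (fun s : ℝ => cEx (-s) X) (-X) 0 := by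
    have h := (cEx_strict 0 (-X)).hasDerivAt
    simpa [cEx_neg_op, cEx_zero] using h
  have h3 := (h1.mul_const A).mul h2
  have h4 := hasDerivAt_mem_submodule (CAlg S) h3 (fun t => CAlg_conj hX t hA)
  simpa [cEx_zero, sub_eq_add_neg] using h4

theorem CAlg_bracket {S : Set (V →L[ℂ] V)} {A B : V →L[ℂ] V} (hB : B ∈ CAlg S)
    (hA : A ∈ CAlg S) : B * A - A * B ∈ CAlg S := by
  have key : ∀ B, CConj S B → ∀ A ∈ CAlg S, B * A - A * B ∈ CAlg S := by
    intro B hB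
    induction hB with
    | base Y hY => intro A hA; exact CAlg_bracket_base hY hA
    | step B X t hX ht _ ih =>
      intro A hA
      have h1 := ih _ (CAlg_conj hX t hA)
      have h2 := CAlg_conj hX (-t) h1
      rw [neg_neg] at h2
      convert h2 using 1
      have e1 := cEx_neg_mul t X
      have e2 := cEx_mul_neg t X
      have e3 : ∀ C : V →L[ℂ] V, cEx t X * (cEx (-t) X * C) = C := fun C => by
        rw [← mul_assoc, e2, one_mul]
      have e4 : ∀ C : V →L[ℂ] V, cEx (-t) X * (cEx t X * C) = C := fun C => by
        rw [← mul_assoc, e1, one_mul]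
      simp only [mul_sub, sub_mul, mul_assoc, e1, e4, mul_one]
  unfold CAlg at hB
  induction hB using Submodule.span_induction with
  | mem B hB => exact key B hB A hA
  | zero => simp
  | add B C _ _ h1 h2 =>
    have : (B + C) * A - A * (B + C) = (B * A - A * B) + (C * A - A * C) := by
      rw [add_mul, mul_add]; abel
    rw [this]; exact (CAlg S).add_mem h1 h2
  | smul c B _ h =>
    have : (c • B) * A - A * (c • B) = c • (B * A - A * B) := by
      simp [smul_sub]
    rw [this]; exact (CAlg S).smul_mem _ h

theorem CAlg_mem {S : Set (V →L[ℂ] V)} {X : V →L[ℂ] V} (hX : X ∈ S) : X ∈ CAlg S :=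
  Submodule.subset_span (CConj.base X hX)

/-- maximality -/
def CMax (S : Set (V →L[ℂ] V)) (x p : V) (K : Submodule ℝ V) : Prop :=
  CAttain S x p K ∧ ∀ p' K', CAttain S x p' K' → Module.finrank ℝ K' ≤ Module.finrank ℝ K

theorem cEx_inj (t : ℝ) (X : V →L[ℂ] V) :
    Function.Injective ((cEx t X).restrictScalars ℝ : V →ₗ[ℝ] V) := by
  intro a b hab
  have h : cEx t X a = cEx t X b := hab
  rw [← cEx_neg_apply t X a, h, cEx_neg_apply]

theorem CMax.mem_gen {S : Set (V →L[ℂ] V)} {x p : V} {K : Submodule ℝ V} (h : CMax S x p K)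
    {X : V →L[ℂ] V} (hX : X ∈ S) : X p ∈ K := by
  have : FiniteDimensional ℝ V := FiniteDimensional.complexToReal V
  have h1 := h.2 _ _ (h.1.step hX one_pos)
  rw [finrank_map_inj _ (cEx_inj 1 X)] at h1
  have h2 : K = K ⊔ Submodule.span ℝ {X p} :=
    Submodule.eq_of_le_of_finrank_le le_sup_left h1
  rw [h2]
  exact Submodule.mem_sup_right (Submodule.mem_span_singleton_self _)

theorem CMax.step {S : Set (V →L[ℂ] V)} {x p : V} {K : Submodule ℝ V} (h : CMax S x p K)
    {X : V →L[ℂ] V} (hX : X ∈ S) {t : ℝ} (ht : 0 < t) :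
    CMax S x (cEx t X p) (K.map ((cEx t X).restrictScalars ℝ : V →ₗ[ℝ] V)) := by
  have h1 := h.1.step hX ht
  have h2 : K ⊔ Submodule.span ℝ {X p} = K := by
    rw [sup_eq_left, Submodule.span_singleton_le_iff_mem]; exact h.mem_gen hX
  rw [h2] at h1
  refine ⟨h1, fun p' K' h' => ?_⟩
  rw [finrank_map_inj _ (cEx_inj t X)]
  exact h.2 _ _ h'

theorem CMax.mem_conj {S : Set (V →L[ℂ] V)} {x : V} {A : V →L[ℂ] V} (hA : CConj S A) :
    ∀ {p : V} {K : Submodule ℝ V}, CMax S x p K → A p ∈ K := by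
  induction hA with
  | base Y hY => intro p K h; exact h.mem_gen hY
  | step A X t hX ht _ ih =>
    intro p K h
    obtain ⟨q, hq, hq2⟩ := ih (h.step hX ht)
    have h2 : cEx t X q = A (cEx t X p) := hq2
    have h3 : (cEx (-t) X * A * cEx t X) p = q := by
      rw [← cEx_neg_apply t X q, h2]; rfl
    rw [h3]; exact hq

theorem CMax.mem_alg {S : Set (V →L[ℂ] V)} {x p : V} {K : Submodule ℝ V} (h : CMax S x p K)
    {A : V →L[ℂ] V} (hA : A ∈ CAlg S) : A p ∈ K := by
  unfold CAlg at hA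
  induction hA using Submodule.span_induction with
  | mem A hA => exact CMax.mem_conj hA h
  | zero => simp
  | add A B _ _ h1 h2 => exact K.add_mem h1 h2
  | smul c A _ h1 => exact K.smul_mem c h1

/-- the rank condition -/
def CRank (S : Set (V →L[ℂ] V)) : Prop :=
  ∀ L : Submodule ℝ (V →L[ℂ] V), (∀ X ∈ S, X ∈ L) → (∀ A ∈ L, ∀ B ∈ L, B * A - A * B ∈ L) →
    (∀ X ∈ S, ∀ t : ℝ, ∀ A ∈ L, cEx t X * A * cEx (-t) X ∈ L) →
    ∀ x y : V, ‖x‖ = 1 → (∀ A ∈ L, (inner ℂ y (A x)).re = 0) → ∃ c : ℝ, y = (c : ℂ) • x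

theorem CRank.neg {S : Set (V →L[ℂ] V)} (h : CRank S) : CRank {X | -X ∈ S} := by
  intro L h1 h2 h3 x y hx hy
  refine h L (fun X hX => ?_) h2 (fun X hX t A hA => ?_) x y hx hy
  · have := L.neg_mem (h1 (-X) (by simpa using hX))
    simpa using this
  · have := h3 (-X) (by simpa using hX) (-t) A hA
    simpa [cEx_neg_op] using this

theorem COrb.open_orbit {S : Set (V →L[ℂ] V)} (hS : ∀ X ∈ S, IsSkew X) (hR : CRank S) {x : V}
    (hx : ‖x‖ = 1) : ∃ p, COrb S x p ∧ ∀ᶠ z in nhds p, ‖z‖ = 1 → COrb S x z := by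
  have : FiniteDimensional ℝ V := FiniteDimensional.complexToReal V
  obtain ⟨p, K, hK, hm⟩ := CAttain.exists_max S x
  have hM : CMax S x p K := ⟨hK, hm⟩
  have hpo := hK.orb
  have hp1 : ‖p‖ = 1 := by rw [hpo.norm_eq hS, hx]
  refine ⟨p, hpo, ?_⟩
  have htop : K ⊔ Submodule.span ℝ {p} = ⊤ := by
    let _ : InnerProductSpace ℝ V := InnerProductSpace.complexToReal
    rw [← Submodule.orthogonal_eq_bot_iff, Submodule.eq_bot_iff]
    intro y hy
    have hy1 : ∀ z ∈ K ⊔ Submodule.span ℝ {p}, (inner ℂ y z).re = 0 := by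
      intro z hz
      have := (Submodule.mem_orthogonal' _ _).1 hy z hz
      rw [real_inner_eq_re_inner ℂ] at this
      exact this
    obtain ⟨c, rfl⟩ := hR (CAlg S) (fun X hX => CAlg_mem hX)
      (fun A hA B hB => CAlg_bracket hB hA) (fun X hX t A hA => CAlg_conj hX t hA) p y hp1
      (fun A hA => hy1 _ (Submodule.mem_sup_left (hM.mem_alg hA)))
    have h2 := hy1 p (Submodule.mem_sup_right (Submodule.mem_span_singleton_self _))
    rw [inner_smul_left, inner_self_eq_norm_sq_to_K, hp1] at h2
    have : c = 0 := by simpa using h2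
    simp [this]
  obtain ⟨D, i1, i2, i3, F, F', t0, hF, hp, hev, hr⟩ := hK
  have hG : HasStrictFDerivAt (fun q : D × ℝ => q.2 • F q.1)
      (((1 : ℝ) • (F'.comp (ContinuousLinearMap.fst ℝ D ℝ))) +
        (ContinuousLinearMap.snd ℝ D ℝ).smulRight (F t0)) (t0, (1 : ℝ)) := by
    have h2 : HasStrictFDerivAt (fun q : D × ℝ => F q.1)
        (F'.comp (ContinuousLinearMap.fst ℝ D ℝ)) (t0, (1 : ℝ)) :=
      HasStrictFDerivAt.comp (t0, (1 : ℝ)) hF hasStrictFDerivAt_fst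
    have h3 : HasStrictFDerivAt (fun q : D × ℝ => q.2) (ContinuousLinearMap.snd ℝ D ℝ)
      (t0, (1 : ℝ)) := hasStrictFDerivAt_snd
    exact h3.smul h2
  have hcV : CompleteSpace V := FiniteDimensional.complete ℂ V
  have hmap := hG.map_nhds_eq_of_surj (by
    rw [eq_top_iff, ← htop, sup_le_iff]
    constructor
    · rw [← hr]
      rintro _ ⟨d, rfl⟩
      exact ⟨(d, 0), by simp⟩
    · rw [Submodule.span_singleton_le_iff_mem]
      exact ⟨(0, 1), by simp [hp]⟩)
  simp only [one_smul, hp] at hmap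
  rw [← hmap, Filter.eventually_map]
  have a1 : ∀ᶠ q : D × ℝ in nhds (t0, (1 : ℝ)), COrb S x (F q.1) :=
    (continuous_fst.tendsto (t0, (1 : ℝ))).eventually hev
  have a2 : ∀ᶠ q : D × ℝ in nhds (t0, (1 : ℝ)), 0 < q.2 :=
    (continuous_snd.tendsto (t0, (1 : ℝ))).eventually (lt_mem_nhds one_pos)
  filter_upwards [a1, a2] with q h1 h2 h3
  have h4 : ‖F q.1‖ = 1 := by rw [h1.norm_eq hS, hx]
  have h5 : q.2 = 1 := by
    rw [norm_smul, h4, mul_one, Real.norm_eq_abs, abs_of_pos h2] at h3; exact h3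
  rw [h5, one_smul]; exact h1

theorem cEx_recur {X : V →L[ℂ] V} (hX : IsSkew X) {t : ℝ} (ht : 0 < t) (y : V) {ε : ℝ}
    (hε : 0 < ε) : ∃ s : ℝ, 0 ≤ s ∧ ‖cEx s X y - cEx (-t) X y‖ < ε := by
  have : ProperSpace V := FiniteDimensional.proper ℂ V
  have hc : IsCompact (Metric.closedBall (0 : V) ‖y‖) := isCompact_closedBall _ _
  obtain ⟨a, _, φ, hφ, hlim⟩ := hc.tendsto_subseq (x := fun k : ℕ => cEx (k * t) X y) (fun k => by
    simp [cEx_norm hX])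
  have hcau := hlim.cauchySeq
  rw [Metric.cauchySeq_iff] at hcau
  obtain ⟨N, hN⟩ := hcau ε hε
  have h1 := hN (N + 1) (by simp) N le_rfl
  have hlt : φ N < φ (N + 1) := hφ (Nat.lt_succ_self N)
  refine ⟨(φ (N + 1) : ℝ) * t - (φ N : ℝ) * t - t, ?_, ?_⟩
  · have : (φ N : ℝ) + 1 ≤ φ (N + 1) := by exact_mod_cast hlt
    nlinarith
  · rw [dist_eq_norm] at h1
    have e : ∀ s : ℝ, cEx s X y = cEx (-((φ N : ℝ) * t) - t) X (cEx (s + (φ N : ℝ) * t + t) X y) := by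
      intro s
      rw [← mul_apply_eq_comp, ← cEx_add]; congr 2; ring
    rw [e (_ - _ - _), e (-t), ← map_sub, cEx_norm hX]
    have e5 : (φ (N + 1) : ℝ) * t - (φ N : ℝ) * t - t + (φ N : ℝ) * t + t = (φ (N + 1) : ℝ) * t := by
      ring
    have e6 : -t + (φ N : ℝ) * t + t = (φ N : ℝ) * t := by ring
    rw [e5, e6]
    exact h1

theorem COrb.exact {S : Set (V →L[ℂ] V)} (hS : ∀ X ∈ S, IsSkew X) (hR : CRank S) {x y : V}
    (hx : ‖x‖ = 1) (hy : ‖y‖ = 1) : COrb S x y := by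
  have : FiniteDimensional ℝ V := FiniteDimensional.complexToReal V
  -- closure of the orbit
  let C : V → Set V := fun x => closure {z | COrb S x z}
  have hCn : ∀ x, ‖x‖ = 1 → ∀ z ∈ C x, ‖z‖ = 1 := by
    intro x hx z hz
    have : C x ⊆ {z | ‖z‖ = 1} := by
      apply closure_minimal
      · intro z hz
        exact (hz.norm_eq hS).trans hx
      · exact isClosed_eq continuous_norm continuous_const
    exact this hz
  -- invariance
  have hfwd : ∀ x, ∀ X ∈ S, ∀ t : ℝ, 0 < t → ∀ z ∈ C x, cEx t X z ∈ C x := by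
    intro x X hX t ht z hz
    exact map_mem_closure (cEx t X).continuous hz (fun w hw => COrb.step X t hX ht hw)
  have hbwd : ∀ x, ∀ X ∈ S, ∀ t : ℝ, 0 < t → ∀ z ∈ C x, cEx (-t) X z ∈ C x := by
    intro x X hX t ht z hz
    have hcl : IsClosed (C x) := isClosed_closure
    rw [← hcl.closure_eq, Metric.mem_closure_iff]
    intro ε hε
    obtain ⟨s, hs, hs2⟩ := cEx_recur (hS X hX) ht z hε
    refine ⟨cEx s X z, ?_, by rw [dist_comm, dist_eq_norm]; exact hs2⟩
    rcases hs.eq_or_lt with h | h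
    · rw [← h, cEx_zero]; exact hz
    · exact hfwd x X hX s h z hz
  have hsub : ∀ x z, z ∈ C x → C z ⊆ C x := by
    intro x z hz
    apply closure_minimal _ isClosed_closure
    intro w hw
    have hw' : COrb S z w := hw
    clear hw
    induction hw' with
    | refl => exact hz
    | step X t hX ht _ ih => exact hfwd x X hX t ht _ ih
  have hback : ∀ x z w, COrb S z w → w ∈ C x → z ∈ C x := by
    intro x z w hw
    induction hw with
    | refl => exact id
    | @step y X t hX ht _ ih =>
      intro h
      have := hbwd x X hX t ht _ h
      rw [cEx_neg_apply] at this
      exact ih this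
  -- each closure is a neighbourhood of its base point
  have hnb : ∀ x, ‖x‖ = 1 → ∀ᶠ z in nhds x, ‖z‖ = 1 → z ∈ C x := by
    intro x hx
    obtain ⟨p, hp, hev⟩ := COrb.open_orbit hS hR hx
    have key : ∀ p, COrb S x p → (∀ᶠ z in nhds p, ‖z‖ = 1 → z ∈ C x) →
        ∀ᶠ z in nhds x, ‖z‖ = 1 → z ∈ C x := by
      intro p hp
      induction hp with
      | refl => exact id
      | @step y X t hX ht _ ih =>
        intro h
        apply ih
        have h1 := ((cEx t X).continuous.tendsto y).eventually h
        filter_upwards [h1] with z hz hz1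
        have h2 := hz (by rw [cEx_norm (hS X hX), hz1])
        have := hbwd x X hX t ht _ h2
        rwa [cEx_neg_apply] at this
    exact key p hp (hev.mono fun z hz h1 => subset_closure (hz h1))
  -- connectedness
  have hrank : 1 < Module.rank ℝ V := by
    have hne : x ≠ 0 := by intro h; rw [h, norm_zero] at hx; exact zero_ne_one hx
    have hnt : Nontrivial V := ⟨x, 0, hne⟩
    have h1 : 0 < Module.finrank ℂ V := Module.finrank_pos
    have h2 : Module.finrank ℝ V = 2 * Module.finrank ℂ V := finrank_real_of_complex V
    rw [← Module.finrank_eq_rank ℝ V]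
    have h3 : 1 < Module.finrank ℝ V := by omega
    exact_mod_cast h3
  have hconn := isPreconnected_sphere hrank (0 : V) 1
  -- all points
  have hall : ∀ z, ‖z‖ = 1 → z ∈ C x := by
    intro z hz
    by_contra hyC
    let O1 : Set V := interior (C x ∪ {z | ‖z‖ ≠ 1})
    have hO1 : ∀ z ∈ C x, z ∈ O1 := by
      intro z hz
      rw [mem_interior_iff_mem_nhds]
      filter_upwards [hnb z (hCn x hx z hz)] with w hw
      by_cases h : ‖w‖ = 1
      · left; exact hsub x z hz (hw h)
      · right; exact h
    have hd := hconn O1 (C x)ᶜ isOpen_interior isClosed_closure.isOpen_compl (by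
        intro z hz
        by_cases h : z ∈ C x
        · left; exact hO1 z h
        · right; exact h)
      ⟨x, by simpa using hx, hO1 x (subset_closure (COrb.refl x))⟩
      ⟨z, by simpa using hz, hyC⟩
    obtain ⟨z, hz1, hz2, hz3⟩ := hd
    rcases interior_subset hz2 with h | h
    · exact hz3 h
    · exact h (by simpa using hz1)
  -- backward orbit of y has interior
  have hSn : ∀ X ∈ {X : V →L[ℂ] V | -X ∈ S}, IsSkew X := by
    intro X hX a b
    have := hS _ hX a b
    simpa using congrArg (fun z => -z) this
  obtain ⟨p, hp, hev⟩ := COrb.open_orbit hSn hR.neg hy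
  have hp1 : ‖p‖ = 1 := (hp.norm_eq hSn).trans hy
  have hpC := hall p hp1
  obtain ⟨z, hz1, hz2⟩ := (mem_closure_iff_nhds.1 hpC) _ hev
  have h3 : ‖z‖ = 1 := (COrb.norm_eq hS hz2).trans hx
  exact COrb.trans hz2 (COrb.symm_neg (hz1 h3))

end PartA

/-! ## Part B: irreducibility plus one `su(2)` implies the rank condition -/

section PartB

variable {V : Type} [NormedAddCommGroup V] [InnerProductSpace ℂ V]

/-- `x ↦ ⟨b, x⟩ a` -/
noncomputable def cKet (a b : V) : V →L[ℂ] V := (innerSL ℂ b).smulRight a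

theorem cKet_apply (a b x : V) : cKet a b x = inner ℂ b x • a := by
  simp [cKet]

noncomputable def cS1 (e1 e2 : V) : V →L[ℂ] V := cKet e1 e2 - cKet e2 e1
noncomputable def cS2 (e1 e2 : V) : V →L[ℂ] V := Complex.I • (cKet e1 e2 + cKet e2 e1)
noncomputable def cS3 (e1 e2 : V) : V →L[ℂ] V := Complex.I • (cKet e1 e1 - cKet e2 e2)

theorem cS1_apply (e1 e2 x : V) :
    cS1 e1 e2 x = inner ℂ e2 x • e1 + (-inner ℂ e1 x) • e2 := by
  simp [cS1, cKet_apply, sub_eq_add_neg]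

theorem cS2_apply (e1 e2 x : V) :
    cS2 e1 e2 x = (Complex.I * inner ℂ e2 x) • e1 + (Complex.I * inner ℂ e1 x) • e2 := by
  simp [cS2, cKet_apply, smul_smul]

theorem cS3_apply (e1 e2 x : V) :
    cS3 e1 e2 x = (Complex.I * inner ℂ e1 x) • e1 + (-(Complex.I * inner ℂ e2 x)) • e2 := by
  simp [cS3, cKet_apply, smul_smul, sub_eq_add_neg]

/-- iterated bracket -/
noncomputable def cAd (l : List (V →L[ℂ] V)) (A : V →L[ℂ] V) : V →L[ℂ] V :=
  l.foldr (fun B C => B * C - C * B) A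

theorem cAd_mem {L : Submodule ℝ (V →L[ℂ] V)} (hL : ∀ A ∈ L, ∀ B ∈ L, B * A - A * B ∈ L)
    (l : List (V →L[ℂ] V)) (hl : ∀ B ∈ l, B ∈ L) {A : V →L[ℂ] V} (hA : A ∈ L) :
    cAd l A ∈ L := by
  induction l with
  | nil => exact hA
  | cons B l ih =>
    exact hL _ (ih fun C hC => hl C (List.mem_cons_of_mem _ hC)) _ (hl B List.mem_cons_self)

theorem quat_coords {x1 x2 y1 y2 : ℂ} (hx : x1 ≠ 0)
    (h1 : ((starRingEnd ℂ) y1 * x2 - (starRingEnd ℂ) y2 * x1).re = 0)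
    (h2 : (Complex.I * ((starRingEnd ℂ) y1 * x2 + (starRingEnd ℂ) y2 * x1)).re = 0)
    (h3 : (Complex.I * ((starRingEnd ℂ) y1 * x1 - (starRingEnd ℂ) y2 * x2)).re = 0) :
    ∃ c : ℝ, y1 = c * x1 ∧ y2 = c * x2 := by
  have hN : 0 < Complex.normSq x1 + Complex.normSq x2 := by
    have := Complex.normSq_pos.2 hx
    have := Complex.normSq_nonneg x2
    linarith
  rw [Complex.normSq_apply, Complex.normSq_apply] at hN
  simp only [Complex.sub_re, Complex.mul_re, Complex.conj_re, Complex.conj_im, Complex.I_re,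
    Complex.I_im, Complex.sub_im, Complex.mul_im, Complex.add_re, Complex.add_im] at h1 h2 h3
  obtain ⟨c, hc⟩ : ∃ c : ℝ, c * (x1.re * x1.re + x1.im * x1.im + (x2.re * x2.re + x2.im * x2.im))
      = (y1.re * x1.re + y1.im * x1.im + y2.re * x2.re + y2.im * x2.im) :=
    ⟨_, div_mul_cancel₀ _ hN.ne'⟩
  refine ⟨c, ?_, ?_⟩
  · apply Complex.ext
    · simp only [Complex.re_ofReal_mul]
      apply mul_right_cancel₀ hN.ne'
      linear_combination x2.re * h1 - x1.im * h3 - x2.im * h2 - x1.re * hc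
    · simp only [Complex.im_ofReal_mul]
      apply mul_right_cancel₀ hN.ne'
      linear_combination x2.im * h1 + x1.re * h3 + x2.re * h2 - x1.im * hc
  · apply Complex.ext
    · simp only [Complex.re_ofReal_mul]
      apply mul_right_cancel₀ hN.ne'
      linear_combination -x1.re * h1 + x2.im * h3 - x1.im * h2 - x2.re * hc
    · simp only [Complex.im_ofReal_mul]
      apply mul_right_cancel₀ hN.ne'
      linear_combination -x1.im * h1 - x2.re * h3 + x1.re * h2 - x2.im * hc

theorem quat_basis {x1 x2 : ℂ} (hx : x1 ≠ 0) (z1 z2 : ℂ) :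
    ∃ a b c d : ℝ, z1 = a * x1 + b * x2 + c * (Complex.I * x2) + d * (Complex.I * x1) ∧
      z2 = a * x2 + b * (-x1) + c * (Complex.I * x1) + d * (-(Complex.I * x2)) := by
  have hN : 0 < Complex.normSq x1 + Complex.normSq x2 := by
    have := Complex.normSq_pos.2 hx
    have := Complex.normSq_nonneg x2
    linarith
  rw [Complex.normSq_apply, Complex.normSq_apply] at hN
  set N := x1.re * x1.re + x1.im * x1.im + (x2.re * x2.re + x2.im * x2.im) with hNd
  refine ⟨(x1.re * z1.re + x1.im * z1.im + x2.re * z2.re + x2.im * z2.im) / N,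
    (x2.re * z1.re + x2.im * z1.im - x1.re * z2.re - x1.im * z2.im) / N,
    (x2.re * z1.im - x2.im * z1.re + x1.re * z2.im - x1.im * z2.re) / N,
    (x1.re * z1.im - x1.im * z1.re - x2.re * z2.im + x2.im * z2.re) / N, ?_, ?_⟩ <;>
  · apply Complex.ext <;> simp <;> field_simp <;> rw [hNd] <;> ring

end PartB

section PartB2

variable {V : Type} [NormedAddCommGroup V] [InnerProductSpace ℂ V]

theorem cAd_diff {L : Submodule ℝ (V →L[ℂ] V)} {e1 e2 y : V} {k : ℕ}
    (Hk : ∀ l : List (V →L[ℂ] V), (∀ B ∈ l, B ∈ L) → l.length < k → ∀ z1 z2 : ℂ,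
      inner ℂ y (l.prod (z1 • e1 + z2 • e2)) = 0)
    {A : V →L[ℂ] V} (hA : ∀ w, ∃ z1 z2 : ℂ, A w = z1 • e1 + z2 • e2)
    (l : List (V →L[ℂ] V)) (hl : ∀ B ∈ l, B ∈ L) :
    ∀ l' : List (V →L[ℂ] V), (∀ B ∈ l', B ∈ L) → l'.length + l.length ≤ k → ∀ w,
      inner ℂ y (l'.prod (cAd l A w - l.prod (A w))) = 0 := by
  induction l with
  | nil =>
    intro l' _ _ w
    simp [cAd]
  | cons B l ih =>
    intro l' hl' hlen w
    have hl2 : ∀ C ∈ l, C ∈ L := fun C hC => hl C (List.mem_cons_of_mem _ hC)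
    have hB : B ∈ L := hl B List.mem_cons_self
    have ih := ih hl2
    simp only [List.length_cons] at hlen
    have e : l'.prod (cAd (B :: l) A w - (B :: l).prod (A w)) =
        (l' ++ [B]).prod (cAd l A w - l.prod (A w)) -
        l'.prod (cAd l A (B w) - l.prod (A (B w))) - (l' ++ l).prod (A (B w)) := by
      simp [cAd]
      abel
    rw [e, inner_sub_right, inner_sub_right]
    obtain ⟨z1, z2, hz⟩ := hA (B w)
    rw [ih (l' ++ [B]) (by
        intro C hC
        rcases List.mem_append.1 hC with h | h
        · exact hl' C h
        · rw [List.mem_singleton.1 h]; exact hB) (by simp; omega) w,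
      ih l' hl' (by omega) (B w), hz,
      Hk (l' ++ l) (by
        intro C hC
        rcases List.mem_append.1 hC with h | h
        · exact hl' C h
        · exact hl2 C h) (by simp; omega) z1 z2]
    simp

theorem rank_core {L : Submodule ℝ (V →L[ℂ] V)} (hLs : ∀ A ∈ L, IsSkew A)
    (hLb : ∀ A ∈ L, ∀ B ∈ L, B * A - A * B ∈ L)
    (irr : ∀ W : Submodule ℂ V, (∀ A ∈ L, ∀ w ∈ W, A w ∈ W) → W ≠ ⊥ → W = ⊤)
    {e1 e2 : V} (he1 : ‖e1‖ = 1) (he2 : ‖e2‖ = 1) (he : inner ℂ e1 e2 = 0)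
    (m1 : cS1 e1 e2 ∈ L) (m2 : cS2 e1 e2 ∈ L) (m3 : cS3 e1 e2 ∈ L)
    {x y : V} (hx : inner ℂ e1 x ≠ 0) (hy : ∀ A ∈ L, (inner ℂ y (A x)).re = 0) :
    ∃ c : ℝ, y = (c : ℂ) • x := by
  have h11 : inner ℂ e1 e1 = 1 := by rw [inner_self_eq_norm_sq_to_K, he1]; simp
  have h22 : inner ℂ e2 e2 = 1 := by rw [inner_self_eq_norm_sq_to_K, he2]; simp
  have he' : inner ℂ e2 e1 = 0 := by rw [← inner_conj_symm, he]; simp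
  have a1 := hy _ m1
  have a2 := hy _ m2
  have a3 := hy _ m3
  rw [cS1_apply, inner_add_right, inner_smul_right, inner_smul_right, ← inner_conj_symm y e1,
    ← inner_conj_symm y e2] at a1
  rw [cS2_apply, inner_add_right, inner_smul_right, inner_smul_right, ← inner_conj_symm y e1,
    ← inner_conj_symm y e2] at a2
  rw [cS3_apply, inner_add_right, inner_smul_right, inner_smul_right, ← inner_conj_symm y e1,
    ← inner_conj_symm y e2] at a3
  obtain ⟨c, hc1, hc2⟩ := quat_coords (x2 := inner ℂ e2 x) (y1 := inner ℂ e1 y) (y2 := inner ℂ e2 y) hx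
    (by rw [← a1]; congr 1; ring) (by rw [← a2]; congr 1; ring) (by rw [← a3]; congr 1; ring)
  refine ⟨c, ?_⟩
  rw [← sub_eq_zero]
  set y' := y - (c : ℂ) • x with hy'
  have hy1 : inner ℂ y' e1 = 0 := by
    rw [← inner_conj_symm, hy', inner_sub_right, inner_smul_right, hc1]; simp
  have hy2 : inner ℂ y' e2 = 0 := by
    rw [← inner_conj_symm, hy', inner_sub_right, inner_smul_right, hc2]; simp
  have hyA : ∀ A ∈ L, (inner ℂ y' (A x)).re = 0 := by
    intro A hA
    have h1 := hLs A hA x x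
    have h2 : (inner ℂ x (A x)).re = 0 := by
      rw [← inner_conj_symm] at h1
      have := congrArg Complex.re h1
      simp only [Complex.conj_re, Complex.neg_re] at this
      linarith
    rw [hy', inner_sub_left, inner_smul_left, Complex.sub_re, hy A hA]
    simp [h2]
  have r1 : ∀ w, ∃ z1 z2 : ℂ, cS1 e1 e2 w = z1 • e1 + z2 • e2 := fun w => ⟨_, _, cS1_apply _ _ _⟩
  have r2 : ∀ w, ∃ z1 z2 : ℂ, cS2 e1 e2 w = z1 • e1 + z2 • e2 := fun w => ⟨_, _, cS2_apply _ _ _⟩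
  have r3 : ∀ w, ∃ z1 z2 : ℂ, cS3 e1 e2 w = z1 • e1 + z2 • e2 := fun w => ⟨_, _, cS3_apply _ _ _⟩
  have key : ∀ k : ℕ, ∀ l : List (V →L[ℂ] V), (∀ B ∈ l, B ∈ L) → l.length = k → ∀ z1 z2 : ℂ,
      inner ℂ y' (l.prod (z1 • e1 + z2 • e2)) = 0 := by
    intro k
    induction k using Nat.strong_induction_on with
    | _ k ih =>
      intro l hl hlk
      have Hk : ∀ l : List (V →L[ℂ] V), (∀ B ∈ l, B ∈ L) → l.length < k → ∀ z1 z2 : ℂ,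
          inner ℂ y' (l.prod (z1 • e1 + z2 • e2)) = 0 :=
        fun l' hl' hlt z1 z2 => ih _ hlt l' hl' rfl z1 z2
      have D : ∀ A : V →L[ℂ] V, (∀ w, ∃ z1 z2 : ℂ, A w = z1 • e1 + z2 • e2) → ∀ w,
          inner ℂ y' (l.prod (A w)) = inner ℂ y' (cAd l A w) := by
        intro A hA w
        have := cAd_diff Hk hA l hl [] (by simp) (by simp; omega) w
        simp only [List.prod_nil, one_apply_eq_self, inner_sub_right] at this
        exact (sub_eq_zero.1 this).symm
      have q : ∀ A ∈ L, (∀ w, ∃ z1 z2 : ℂ, A w = z1 • e1 + z2 • e2) →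
          (inner ℂ y' (l.prod (A x))).re = 0 := by
        intro A hAL hA
        rw [D A hA]
        exact hyA _ (cAd_mem hLb l hl hAL)
      have q1 := q _ m1 r1
      have q2 := q _ m2 r2
      have q3 := q _ m3 r3
      have q0 : (inner ℂ y' (l.prod (cS1 e1 e2 (cS1 e1 e2 x)))).re = 0 := by
        rw [D _ r1]
        have := hyA _ (hLb _ (cAd_mem hLb l hl m1) _ m1)
        simp only [sub_apply, mul_apply_eq_comp,
          inner_sub_right, Complex.sub_re] at this
        rw [cS1_apply e1 e2 (cAd l _ x), inner_add_right, inner_smul_right, inner_smul_right,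
          hy1, hy2] at this
        simp at this
        exact this
      rw [cS1_apply e1 e2 (cS1 e1 e2 x)] at q0
      rw [cS1_apply] at q1 q0
      rw [cS2_apply] at q2
      rw [cS3_apply] at q3
      simp only [inner_add_right, inner_smul_right, h11, h22, he, he', map_add, map_smul] at q0 q1 q2 q3
      have R : ∀ z1 z2 : ℂ, (inner ℂ y' (l.prod (z1 • e1 + z2 • e2))).re = 0 := by
        intro z1 z2
        obtain ⟨a, b, c, d, hz1, hz2⟩ := quat_basis (x2 := inner ℂ e2 x) hx z1 z2
        simp only [inner_add_right, inner_smul_right, map_add, map_smul]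
        set p1 := inner ℂ y' (l.prod e1)
        set p2 := inner ℂ y' (l.prod e2)
        set x1 := inner ℂ e1 x
        set x2 := inner ℂ e2 x
        have : z1 * p1 + z2 * p2 =
            ((-a : ℝ) : ℂ) * ((x2 * 0 + -x1 * 1) * p1 + -(x2 * 1 + -x1 * 0) * p2)
            + (b : ℂ) * (x2 * p1 + -x1 * p2)
            + (c : ℂ) * (Complex.I * x2 * p1 + Complex.I * x1 * p2)
            + (d : ℂ) * (Complex.I * x1 * p1 + -(Complex.I * x2) * p2) := by
          rw [hz1, hz2]; push_cast; ring
        rw [this]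
        simp only [Complex.add_re, Complex.re_ofReal_mul] at q0 q1 q2 q3 ⊢
        rw [q0, q1, q2, q3]
        simp
      intro z1 z2
      apply Complex.ext
      · exact R z1 z2
      · have := R (Complex.I * z1) (Complex.I * z2)
        rw [mul_smul, mul_smul, ← smul_add, map_smul, inner_smul_right] at this
        simpa only [Complex.I_mul_re, neg_eq_zero, Complex.zero_im] using this
  set W : Submodule ℂ V := Submodule.span ℂ
    {w | ∃ l : List (V →L[ℂ] V), (∀ B ∈ l, B ∈ L) ∧ ∃ z1 z2 : ℂ, w = l.prod (z1 • e1 + z2 • e2)}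
    with hW
  have hWtop : W = ⊤ := by
    apply irr
    · intro A hA w hw
      have : W ≤ W.comap (A : V →ₗ[ℂ] V) := by
        conv_lhs => rw [hW]
        rw [Submodule.span_le]
        rintro w ⟨l, hl, z1, z2, rfl⟩
        apply Submodule.subset_span
        refine ⟨A :: l, ?_, z1, z2, by simp⟩
        intro B hB
        rcases List.mem_cons.1 hB with rfl | h
        · exact hA
        · exact hl B h
      exact this hw
    · intro hb
      have : e1 ∈ W := Submodule.subset_span ⟨[], by simp, 1, 0, by simp⟩
      rw [hb, Submodule.mem_bot] at this
      rw [this] at he1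
      simp at he1
  have hall : ∀ w ∈ W, inner ℂ y' w = 0 := by
    intro w hw
    have : W ≤ LinearMap.ker (innerSL ℂ y' : V →ₗ[ℂ] ℂ) := by
      rw [hW, Submodule.span_le]
      rintro w ⟨l, hl, z1, z2, rfl⟩
      exact key _ l hl rfl z1 z2
    simpa using this hw
  exact inner_self_eq_zero.1 (hall y' (by rw [hWtop]; trivial))

end PartB2

section PartB3

variable {V : Type} [NormedAddCommGroup V] [InnerProductSpace ℂ V] [FiniteDimensional ℂ V]

/-- simultaneous orbit of a pair -/
inductive CPair (S : Set (V →L[ℂ] V)) (x y : V) : V → V → Prop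
  | base : CPair S x y x y
  | step {p q : V} (X : V →L[ℂ] V) (t : ℝ) (hX : X ∈ S) (h : CPair S x y p q) :
      CPair S x y (cEx t X p) (cEx t X q)

theorem IsSkew.cEx_adj {X : V →L[ℂ] V} (hX : IsSkew X) (t : ℝ) (x y : V) :
    inner ℂ (cEx t X x) y = inner ℂ x (cEx (-t) X y) := by
  conv_lhs => rw [← cEx_apply_neg t X y]
  rw [cEx_inner hX]

/-- real subspace of skew operators -/
def skewSub (V : Type) [NormedAddCommGroup V] [InnerProductSpace ℂ V] :
    Submodule ℝ (V →L[ℂ] V) where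
  carrier := {A | ∀ x y, inner ℂ (A x) y = - inner ℂ x (A y)}
  add_mem' := by
    intro A B hA hB x y
    simp only [add_apply, inner_add_left, inner_add_right]
    rw [hA, hB]; ring
  zero_mem' := by intro x y; simp
  smul_mem' := by
    intro c A hA x y
    have e : ∀ z, (c • A) z = (c : ℂ) • A z := fun z => by simp
    rw [e, e, inner_smul_left, inner_smul_right, hA x y]
    simp

theorem crank_of {S : Set (V →L[ℂ] V)} (hS : ∀ X ∈ S, IsSkew X)
    (irr : ∀ W : Submodule ℂ V, (∀ X ∈ S, ∀ w ∈ W, X w ∈ W) → W ≠ ⊥ → W = ⊤)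
    (su : ∀ L : Submodule ℝ (V →L[ℂ] V), (∀ X ∈ S, X ∈ L) → (∀ A ∈ L, IsSkew A) →
      (∀ A ∈ L, ∀ B ∈ L, B * A - A * B ∈ L) → ∃ e1 e2 : V, ‖e1‖ = 1 ∧ ‖e2‖ = 1 ∧
        inner ℂ e1 e2 = 0 ∧ cS1 e1 e2 ∈ L ∧ cS2 e1 e2 ∈ L ∧ cS3 e1 e2 ∈ L) :
    CRank S := by
  intro L0 hSL0 hbr0 hconj0 x y hx hxy0
  set L := L0 ⊓ skewSub V with hL
  have hSL : ∀ X ∈ S, X ∈ L := fun X hX => ⟨hSL0 X hX, hS X hX⟩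
  have hsk : ∀ A ∈ L, IsSkew A := fun A hA => hA.2
  have hbr : ∀ A ∈ L, ∀ B ∈ L, B * A - A * B ∈ L := by
    intro A hA B hB
    refine ⟨hbr0 A hA.1 B hB.1, ?_⟩
    intro u v
    simp only [sub_apply, mul_apply_eq_comp, inner_sub_left, inner_sub_right]
    rw [hsk B hB, hsk A hA, hsk A hA, hsk B hB]; ring
  have hconj : ∀ X ∈ S, ∀ t : ℝ, ∀ A ∈ L, cEx t X * A * cEx (-t) X ∈ L := by
    intro X hX t A hA
    refine ⟨hconj0 X hX t A hA.1, ?_⟩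
    intro u v
    simp only [mul_apply_eq_comp]
    rw [(hS X hX).cEx_adj, hsk A hA, (hS X hX).cEx_adj, neg_neg]
  have hxy : ∀ A ∈ L, (inner ℂ y (A x)).re = 0 := fun A hA => hxy0 A hA.1
  obtain ⟨e1, e2, he1, he2, he, m1, m2, m3⟩ := su L hSL hsk hbr
  have hpair : ∀ p q, CPair S x y p q → (∀ A ∈ L, (inner ℂ q (A p)).re = 0) ∧
      (∀ c : ℝ, q = (c : ℂ) • p → y = (c : ℂ) • x) := by
    intro p q h
    induction h with
    | base => exact ⟨hxy, fun c h => h⟩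
    | @step p q X t hX _ ih =>
      refine ⟨fun A hA => ?_, fun c hc => ih.2 c ?_⟩
      · rw [(hS X hX).cEx_adj]
        have := ih.1 _ (hconj X hX (-t) A hA)
        simpa [mul_apply_eq_comp] using this
      · have := congrArg (cEx (-t) X) hc
        rw [map_smul, cEx_neg_apply, cEx_neg_apply] at this
        exact this
  have hex : ∃ p q, CPair S x y p q ∧ inner ℂ e1 p ≠ 0 := by
    by_contra hno
    push Not at hno
    set W : Submodule ℂ V := Submodule.span ℂ {p | ∃ q, CPair S x y p q} with hW
    have hle : W ≤ LinearMap.ker (innerSL ℂ e1 : V →ₗ[ℂ] ℂ) := by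
      rw [hW, Submodule.span_le]
      rintro p ⟨q, hpq⟩
      exact hno p q hpq
    have htop : W = ⊤ := by
      apply irr
      · intro X hX w hw
        have : W ≤ W.comap (X : V →ₗ[ℂ] V) := by
          conv_lhs => rw [hW]
          rw [Submodule.span_le]
          rintro p ⟨q, hpq⟩
          have : FiniteDimensional ℝ V := FiniteDimensional.complexToReal V
          have h1 := cEx_apply_hasDerivAt 0 X p
          rw [cEx_zero, one_apply_eq_self] at h1
          exact hasDerivAt_mem_submodule (W.restrictScalars ℝ) h1
            (fun t => Submodule.subset_span ⟨_, CPair.step X t hX hpq⟩)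
        exact this hw
      · intro hb
        have : x ∈ W := Submodule.subset_span ⟨y, CPair.base⟩
        rw [hb, Submodule.mem_bot] at this
        rw [this] at hx
        simp at hx
    have h1 : e1 ∈ W := by rw [htop]; trivial
    have h2 : inner ℂ e1 e1 = 0 := hle h1
    rw [inner_self_eq_zero] at h2
    rw [h2] at he1
    simp at he1
  obtain ⟨p, q, hpq, hp⟩ := hex
  obtain ⟨c, hc⟩ := rank_core hsk hbr
    (fun W hW => irr W fun X hX => hW X (hSL X hX)) he1 he2 he m1 m2 m3 hp (hpair p q hpq).1
  exact ⟨c, (hpair p q hpq).2 c hc⟩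

end PartB3

/-! ## Part C: spectral analysis -/

section PartC1

variable {V : Type} [NormedAddCommGroup V] [InnerProductSpace ℂ V] [FiniteDimensional ℂ V] {n : ℕ}

/-- `b` is a diagonalising orthonormal basis -/
def DiagBy (T : V →L[ℂ] V) (b : OrthonormalBasis (Fin n) ℂ V) (μ : Fin n → ℝ) : Prop :=
  ∀ l, T (b l) = (μ l : ℂ) • b l

theorem DiagBy.inner_apply {T : V →L[ℂ] V} {b : OrthonormalBasis (Fin n) ℂ V} {μ : Fin n → ℝ}
    (h : DiagBy T b μ) (i : Fin n) (w : V) :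
    inner ℂ (b i) (T w) = μ i * inner ℂ (b i) w := by
  conv_lhs => rw [← b.sum_repr' w]
  rw [map_sum, inner_sum, Finset.sum_eq_single i]
  · rw [map_smul, h i, inner_smul_right, inner_smul_right, b.inner_eq_one]
    ring
  · intro j _ hj
    rw [map_smul, h j, inner_smul_right, inner_smul_right, b.inner_eq_zero hj.symm]
    simp
  · simp

theorem DiagBy.re_inner {T : V →L[ℂ] V} {b : OrthonormalBasis (Fin n) ℂ V} {μ : Fin n → ℝ}
    (h : DiagBy T b μ) (w : V) :
    (inner ℂ w (T w)).re = ∑ i, μ i * ‖inner ℂ (b i) w‖ ^ 2 := by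
  rw [← b.sum_inner_mul_inner, Complex.re_sum]
  refine Finset.sum_congr rfl fun i _ => ?_
  rw [h.inner_apply, ← inner_conj_symm w (b i)]
  have : (starRingEnd ℂ) (inner ℂ (b i) w) * ((μ i : ℂ) * inner ℂ (b i) w) =
      ((μ i * ‖inner ℂ (b i) w‖ ^ 2 : ℝ) : ℂ) := by
    push_cast
    rw [← Complex.conj_mul']
    ring
  rw [this, Complex.ofReal_re]

theorem weyl_aux {T T' : V →L[ℂ] V} {b b' : OrthonormalBasis (Fin n) ℂ V} {μ μ' : Fin n → ℝ}
    (h : DiagBy T b μ) (h' : DiagBy T' b' μ') (hμ : Monotone μ) (hμ' : Monotone μ')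
    {δ : ℝ} (hδ : ∀ x, ‖T x - T' x‖ ≤ δ * ‖x‖) (l : Fin n) : μ' l ≤ μ l + δ := by
  let φ : V →ₗ[ℂ] (Fin n → ℂ) := LinearMap.pi fun i =>
    if i < l then (innerSL ℂ (b' i) : V →ₗ[ℂ] ℂ) else
      if l < i then (innerSL ℂ (b i) : V →ₗ[ℂ] ℂ) else 0
  have hns : ¬ Function.Surjective φ := by
    intro hs
    obtain ⟨w, hw⟩ := hs (fun _ => 1)
    have := congrFun hw l
    simp [φ] at this
  have hfin : Module.finrank ℂ V = Module.finrank ℂ (Fin n → ℂ) := by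
    rw [Module.finrank_eq_card_basis b.toBasis]; simp
  have hni : ¬ Function.Injective φ := fun hi =>
    hns ((LinearMap.injective_iff_surjective_of_finrank_eq_finrank hfin).1 hi)
  rw [← LinearMap.ker_eq_bot, Submodule.eq_bot_iff] at hni
  push Not at hni
  obtain ⟨w, hw, hw0⟩ := hni
  have hwn : 0 < ‖w‖ ^ 2 := by positivity
  have k1 : ∀ i, l < i → inner ℂ (b i) w = 0 := by
    intro i hi
    have := congrFun (LinearMap.mem_ker.1 hw) i
    simpa [φ, hi, hi.not_gt] using this
  have k2 : ∀ i, i < l → inner ℂ (b' i) w = 0 := by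
    intro i hi
    have := congrFun (LinearMap.mem_ker.1 hw) i
    simpa [φ, hi] using this
  have s1 : (inner ℂ w (T w)).re ≤ μ l * ‖w‖ ^ 2 := by
    rw [h.re_inner, ← b.sum_sq_norm_inner_right w, Finset.mul_sum]
    refine Finset.sum_le_sum fun i _ => ?_
    by_cases hi : l < i
    · rw [k1 i hi]; simp
    · exact mul_le_mul_of_nonneg_right (hμ (not_lt.1 hi)) (by positivity)
  have s2 : μ' l * ‖w‖ ^ 2 ≤ (inner ℂ w (T' w)).re := by
    rw [h'.re_inner, ← b'.sum_sq_norm_inner_right w, Finset.mul_sum]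
    refine Finset.sum_le_sum fun i _ => ?_
    by_cases hi : i < l
    · rw [k2 i hi]; simp
    · exact mul_le_mul_of_nonneg_right (hμ' (not_lt.1 hi)) (by positivity)
  have s3 : (inner ℂ w (T' w)).re - (inner ℂ w (T w)).re ≤ δ * ‖w‖ ^ 2 := by
    rw [← Complex.sub_re, ← inner_sub_right]
    calc (inner ℂ w (T' w - T w)).re ≤ ‖inner ℂ w (T' w - T w)‖ := Complex.re_le_norm _
      _ ≤ ‖w‖ * ‖T' w - T w‖ := norm_inner_le_norm _ _
      _ ≤ ‖w‖ * (δ * ‖w‖) := by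
        rw [norm_sub_rev]
        exact mul_le_mul_of_nonneg_left (hδ w) (norm_nonneg _)
      _ = δ * ‖w‖ ^ 2 := by ring
  nlinarith

theorem weyl {T T' : V →L[ℂ] V} {b b' : OrthonormalBasis (Fin n) ℂ V} {μ μ' : Fin n → ℝ}
    (h : DiagBy T b μ) (h' : DiagBy T' b' μ') (hμ : Monotone μ) (hμ' : Monotone μ')
    (l : Fin n) : |μ' l - μ l| ≤ ‖T' - T‖ := by
  rw [abs_le]
  have h1 := weyl_aux h h' hμ hμ' (δ := ‖T' - T‖) (fun x => by
    rw [norm_sub_rev]; exact (T' - T).le_opNorm x) l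
  have h2 := weyl_aux h' h hμ' hμ (δ := ‖T' - T‖) (fun x => (T' - T).le_opNorm x) l
  constructor <;> linarith

/-- two approximate eigenvectors give two nearby eigenvalues -/
theorem two_near {T : V →L[ℂ] V} {b : OrthonormalBasis (Fin n) ℂ V} {μ : Fin n → ℝ}
    (h : DiagBy T b μ) {w1 w2 : V} {ν δ : ℝ} (hδ : 0 ≤ δ)
    (hw : ∀ α γ : ℂ, ‖T (α • w1 + γ • w2) - (ν : ℂ) • (α • w1 + γ • w2)‖
      ≤ δ * ‖α • w1 + γ • w2‖)
    (hne : ∀ α γ : ℂ, α • w1 + γ • w2 = 0 → α = 0 ∧ γ = 0) :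
    ∃ p q : Fin n, p ≠ q ∧ |μ p - ν| ≤ δ ∧ |μ q - ν| ≤ δ := by
  have key : ∀ α γ : ℂ, (∀ i, |μ i - ν| ≤ δ → inner ℂ (b i) (α • w1 + γ • w2) = 0) →
      α = 0 ∧ γ = 0 := by
    intro α γ hz
    apply hne
    set w := α • w1 + γ • w2 with hwd
    by_contra hw0
    have h1 := hw α γ
    rw [← hwd] at h1
    have hsq : ‖T w - (ν : ℂ) • w‖ ^ 2 ≤ δ ^ 2 * ‖w‖ ^ 2 := by
      rw [← mul_pow]
      exact pow_le_pow_left₀ (norm_nonneg _) h1 2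
    rw [← b.sum_sq_norm_inner_right w, ← b.sum_sq_norm_inner_right, Finset.mul_sum] at hsq
    have e : ∀ i, ‖inner ℂ (b i) (T w - (ν : ℂ) • w)‖ ^ 2 = (μ i - ν) ^ 2 * ‖inner ℂ (b i) w‖ ^ 2 := by
      intro i
      rw [inner_sub_right, h.inner_apply, inner_smul_right, ← sub_mul, norm_mul, mul_pow,
        ← Complex.ofReal_sub, Complex.norm_real, Real.norm_eq_abs, sq_abs]
    simp only [e] at hsq
    obtain ⟨i, hi⟩ : ∃ i, inner ℂ (b i) w ≠ 0 := by
      by_contra hno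
      push Not at hno
      apply hw0
      rw [← b.sum_repr' w]
      exact Finset.sum_eq_zero fun i _ => by rw [hno i, zero_smul]
    have hlt : ∑ i, δ ^ 2 * ‖inner ℂ (b i) w‖ ^ 2 < ∑ i, (μ i - ν) ^ 2 * ‖inner ℂ (b i) w‖ ^ 2 := by
      apply Finset.sum_lt_sum
      · intro k _
        by_cases hk : |μ k - ν| ≤ δ
        · rw [hz k hk]; simp
        · have : δ ^ 2 ≤ (μ k - ν) ^ 2 := by
            rw [← sq_abs (μ k - ν)]
            exact pow_le_pow_left₀ hδ (not_le.1 hk).le 2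
          exact mul_le_mul_of_nonneg_right this (by positivity)
      · refine ⟨i, Finset.mem_univ _, ?_⟩
        have hk : ¬ |μ i - ν| ≤ δ := fun hk => hi (hz i hk)
        have : δ ^ 2 < (μ i - ν) ^ 2 := by
          rw [← sq_abs (μ i - ν)]
          exact pow_lt_pow_left₀ (not_le.1 hk) hδ (by norm_num)
        exact mul_lt_mul_of_pos_right this (by positivity)
    linarith
  obtain ⟨p, hp⟩ : ∃ p, |μ p - ν| ≤ δ := by
    by_contra hno
    have := (key 1 0 fun i hi => (hno ⟨i, hi⟩).elim).1
    simp at this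
  by_contra hno
  push Not at hno
  have huniq : ∀ q, |μ q - ν| ≤ δ → q = p := by
    intro q hq
    by_contra hqp
    exact absurd hq (not_le.2 (hno p q (Ne.symm hqp) hp))
  by_cases hz : inner ℂ (b p) w1 = 0
  · have := (key 1 0 (by
      intro i hi
      rw [huniq i hi]
      simp [hz])).1
    simp at this
  · have := (key (inner ℂ (b p) w2) (-inner ℂ (b p) w1) (by
      intro i hi
      rw [huniq i hi, inner_add_right, inner_smul_right, inner_smul_right]
      ring)).2
    exact hz (neg_eq_zero.1 this)

end PartC1

section PartC2

variable {V : Type} [NormedAddCommGroup V] [InnerProductSpace ℂ V] [FiniteDimensional ℂ V] {n : ℕ}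

theorem onb_ext (b : OrthonormalBasis (Fin n) ℂ V) {x y : V}
    (h : ∀ i, inner ℂ (b i) x = inner ℂ (b i) y) : x = y := by
  rw [← b.sum_repr' x, ← b.sum_repr' y]
  exact Finset.sum_congr rfl fun i _ => by rw [h i]

theorem exists_gap (μ : Fin n → ℝ) (a : ℝ) : ∃ g > 0, ∀ l, |μ l - a| < g → μ l = a := by
  have : ∀ s : Finset (Fin n), ∃ g > 0, ∀ l ∈ s, |μ l - a| < g → μ l = a := by
    intro s
    induction s using Finset.induction_on with
    | empty => exact ⟨1, one_pos, by simp⟩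
    | insert i s _ ih =>
      obtain ⟨g, hg, h⟩ := ih
      by_cases hi : μ i = a
      · refine ⟨g, hg, fun l hl hlt => ?_⟩
        rcases Finset.mem_insert.1 hl with rfl | hl
        · exact hi
        · exact h l hl hlt
      · have hpos : 0 < |μ i - a| := abs_pos.2 (sub_ne_zero.2 hi)
        refine ⟨min g |μ i - a|, lt_min hg hpos, fun l hl hlt => ?_⟩
        rcases Finset.mem_insert.1 hl with rfl | hl
        · exact absurd hlt (not_lt.2 (min_le_right _ _))
        · exact h l hl (hlt.trans_le (min_le_left _ _))
  obtain ⟨g, hg, h⟩ := this Finset.univ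
  exact ⟨g, hg, fun l => h l (Finset.mem_univ _)⟩

theorem gap_contra {T0 D : V →L[ℂ] V} {b : OrthonormalBasis (Fin n) ℂ V} {μ : Fin n → ℝ}
    (h : DiagBy T0 b μ) (hμ : Monotone μ) {j k : Fin n}
    (hjk : ∀ l, μ l = μ j ↔ (l = j ∨ l = k)) {ε c : ℝ} (hε : 0 < ε) (hc : 0 < c)
    {lamt : ℝ → Fin n → ℝ}
    (hspec : ∀ t : ℝ, 0 < t → t < ε → Monotone (lamt t) ∧
      ∃ b' : OrthonormalBasis (Fin n) ℂ V, DiagBy (T0 + (t : ℂ) • D) b' (lamt t))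
    (hgap : ∀ t : ℝ, 0 < t → t < ε → lamt t k - lamt t j > c * t) (β : ℝ)
    (hD : ∀ x y, T0 x = (μ j : ℂ) • x → T0 y = (μ j : ℂ) • y →
      inner ℂ x (D y) = β * inner ℂ x y) : False := by
  have hkj : μ k = μ j := (hjk k).2 (Or.inr rfl)
  have hne : j ≠ k := by
    rintro rfl
    have := hgap (ε / 2) (by linarith) (by linarith)
    have h2 : 0 < c * (ε / 2) := by positivity
    linarith
  set M : V →L[ℂ] V := D - (β : ℂ) • (1 : V →L[ℂ] V) with hM
  have hMa : ∀ x, M x = D x - (β : ℂ) • x := fun x => by simp [hM]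
  let r : Fin n → ℂ := fun l => if μ l = μ j then 0 else -(((μ l - μ j : ℝ) : ℂ))⁻¹
  set R : V →L[ℂ] V := (∑ l, r l • cKet (b l) (b l)) * M with hR
  have hRa : ∀ i x, inner ℂ (b i) (R x) = r i * inner ℂ (b i) (M x) := by
    intro i x
    have : R x = ∑ l, (r l * inner ℂ (b l) (M x)) • b l := by
      simp [hR, mul_apply_eq_comp, cKet_apply, smul_smul]
    rw [this, b.orthonormal.inner_right_fintype]
  have hj : T0 (b j) = (μ j : ℂ) • b j := h j
  have hk : T0 (b k) = (μ j : ℂ) • b k := by rw [h k, hkj]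
  -- the first order corrector equation
  have hcor : ∀ e, T0 e = (μ j : ℂ) • e → T0 (R e) - (μ j : ℂ) • R e = - M e := by
    intro e he
    apply onb_ext b
    intro i
    rw [inner_sub_right, h.inner_apply, inner_smul_right, hRa, inner_neg_right]
    by_cases hi : μ i = μ j
    · have h1 : inner ℂ (b i) (M e) = 0 := by
        rw [hMa, inner_sub_right, inner_smul_right, hD (b i) e (by rw [h i, hi]) he, sub_self]
      simp [r, hi, h1]
    · have h2 : ((μ i - μ j : ℝ) : ℂ) ≠ 0 := by
        rw [Complex.ofReal_ne_zero]; exact sub_ne_zero.2 hi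
      simp only [r, hi, if_false]
      push_cast at h2 ⊢
      field_simp
      ring
  have horth : ∀ e f, T0 e = (μ j : ℂ) • e → inner ℂ e (R f) = 0 := by
    intro e f he
    rw [← b.sum_inner_mul_inner]
    refine Finset.sum_eq_zero fun i _ => ?_
    rw [hRa]
    by_cases hi : μ i = μ j
    · simp [r, hi]
    · have h1 := h.inner_apply i e
      rw [he, inner_smul_right] at h1
      have h3 : ((μ i : ℂ) - μ j) * inner ℂ (b i) e = 0 := by rw [sub_mul, h1, sub_self]
      have h2 : ((μ i : ℂ) - μ j) ≠ 0 := by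
        rw [← Complex.ofReal_sub, Complex.ofReal_ne_zero]; exact sub_ne_zero.2 hi
      have h4 := (mul_eq_zero.1 h3).resolve_left h2
      rw [← inner_conj_symm, h4]; simp
  set C := ‖M‖ * ‖R‖ with hC
  have hC0 : 0 ≤ C := by positivity
  obtain ⟨g, hg, hgl⟩ := exists_gap μ (μ j)
  set K := ‖D‖ + |β| + C + 1 with hK
  have hK0 : 0 < K := by positivity
  obtain ⟨t, ht0, ht⟩ := exists_between (show (0:ℝ) < min (min ε 1) (min (g / K) (c / (2 * C + 1)))
    from by positivity)
  simp only [lt_min_iff] at ht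
  obtain ⟨⟨htε, ht1⟩, htg, htc⟩ := ht
  rw [lt_div_iff₀ hK0] at htg
  rw [lt_div_iff₀ (by positivity)] at htc
  obtain ⟨hmono, b', hb'⟩ := hspec t ht0 htε
  have hgp := hgap t ht0 htε
  have hnorm : ∀ e f, T0 e = (μ j : ℂ) • e → ‖e‖ ≤ ‖e + (t : ℂ) • R f‖ := by
    intro e f he
    have h1 : inner ℂ e (e + (t : ℂ) • R f) = inner ℂ e e := by
      rw [inner_add_right, inner_smul_right, horth e f he]; simp
    by_cases h0 : ‖e‖ = 0
    · rw [h0]; positivity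
    · have h2 : ‖e‖ * ‖e‖ ≤ ‖e‖ * ‖e + (t : ℂ) • R f‖ := by
        have h3 : ‖inner ℂ e e‖ = ‖e‖ * ‖e‖ := by
          rw [inner_self_eq_norm_sq_to_K]; simp [sq]
        rw [← h3, ← h1]
        exact norm_inner_le_norm _ _
      exact le_of_mul_le_mul_left h2 (by positivity)
  have hE : ∀ α γ : ℂ, T0 (α • b j + γ • b k) = (μ j : ℂ) • (α • b j + γ • b k) := by
    intro α γ
    rw [map_add, map_smul, map_smul, hj, hk]
    module
  have hcomb : ∀ α γ : ℂ, α • (b j + (t : ℂ) • R (b j)) + γ • (b k + (t : ℂ) • R (b k)) =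
      (α • b j + γ • b k) + (t : ℂ) • R (α • b j + γ • b k) := by
    intro α γ
    rw [map_add, map_smul, map_smul]
    module
  obtain ⟨p, q, hpq, hp, hq⟩ := two_near hb' (w1 := b j + (t : ℂ) • R (b j))
    (w2 := b k + (t : ℂ) • R (b k)) (ν := μ j + t * β) (δ := C * t ^ 2) (by positivity)
    (by
      intro α γ
      rw [hcomb]
      set e := α • b j + γ • b k with he
      have hTe : T0 e = (μ j : ℂ) • e := hE α γ
      have : (T0 + (t : ℂ) • D) (e + (t : ℂ) • R e) - ((μ j + t * β : ℝ) : ℂ) • (e + (t : ℂ) • R e)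
          = ((t : ℂ) ^ 2) • M (R e) := by
        have h1 := hcor e hTe
        rw [hMa] at h1
        rw [hMa]
        simp only [add_apply, smul_apply, map_add, map_smul, hTe]
        have h2 : T0 (R e) = (μ j : ℂ) • R e - (D e - (β : ℂ) • e) := by
          rw [sub_eq_iff_eq_add] at h1; rw [h1]; abel
        rw [h2]
        push_cast
        module
      rw [this, norm_smul]
      have h3 : ‖M (R e)‖ ≤ C * ‖e + (t : ℂ) • R e‖ :=
        calc ‖M (R e)‖ ≤ ‖M‖ * ‖R e‖ := M.le_opNorm _
          _ ≤ ‖M‖ * (‖R‖ * ‖e‖) := by gcongr; exact R.le_opNorm _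
          _ = C * ‖e‖ := by rw [hC]; ring
          _ ≤ C * ‖e + (t : ℂ) • R e‖ := by gcongr; exact hnorm e e hTe
      have h4 : ‖((t : ℂ) ^ 2)‖ = t ^ 2 := by
        rw [norm_pow, Complex.norm_real, Real.norm_eq_abs, sq_abs]
      rw [h4]
      nlinarith [sq_nonneg t])
    (by
      intro α γ h0
      rw [hcomb] at h0
      have h1 := hnorm _ (α • b j + γ • b k) (hE α γ)
      rw [h0, norm_zero] at h1
      have h2 : α • b j + γ • b k = 0 := norm_eq_zero.1 (le_antisymm h1 (norm_nonneg _))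
      constructor
      · have := congrArg (inner ℂ (b j)) h2
        simpa [inner_add_right, inner_smul_right, b.inner_eq_zero hne] using this
      · have := congrArg (inner ℂ (b k)) h2
        simpa [inner_add_right, inner_smul_right, b.inner_eq_zero hne.symm] using this)
  have hnear : ∀ p, |lamt t p - (μ j + t * β)| ≤ C * t ^ 2 → p = j ∨ p = k := by
    intro p hp
    rw [← hjk]
    apply hgl
    have h1 := weyl h hb' hμ hmono p
    have h2 : ‖T0 + (t : ℂ) • D - T0‖ = t * ‖D‖ := by
      rw [add_sub_cancel_left, norm_smul, Complex.norm_real, Real.norm_eq_abs, abs_of_pos ht0]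
    rw [h2] at h1
    have h3 : |t * β| = t * |β| := by rw [abs_mul, abs_of_pos ht0]
    have h4 : μ p - μ j = -(lamt t p - μ p) + (lamt t p - (μ j + t * β)) + t * β := by ring
    have h5 : C * t ^ 2 ≤ C * t := mul_le_mul_of_nonneg_left (by nlinarith) hC0
    calc |μ p - μ j| ≤ |lamt t p - μ p| + |lamt t p - (μ j + t * β)| + |t * β| := by
          rw [h4]
          refine (abs_add_le _ _).trans (add_le_add ((abs_add_le _ _).trans ?_) le_rfl)
          rw [abs_neg]
      _ ≤ t * ‖D‖ + C * t + t * |β| := by rw [h3]; linarith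
      _ < g := by rw [hK] at htg; nlinarith
  have hfin : |lamt t k - lamt t j| ≤ 2 * (C * t ^ 2) := by
    have gen : ∀ p q, |lamt t p - (μ j + t * β)| ≤ C * t ^ 2 →
        |lamt t q - (μ j + t * β)| ≤ C * t ^ 2 → |lamt t p - lamt t q| ≤ 2 * (C * t ^ 2) := by
      intro p q hp hq
      rw [abs_le] at *
      constructor <;> linarith [hp.1, hp.2, hq.1, hq.2]
    rcases hnear p hp with rfl | rfl <;> rcases hnear q hq with rfl | rfl
    · exact absurd rfl hpq
    · exact gen _ _ hq hp
    · exact gen _ _ hp hq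
    · exact absurd rfl hpq
  have := (abs_le.1 hfin).2
  nlinarith

theorem span_pair_eq {W : Submodule ℂ V} {b1 b2 e1 e2 : V}
    (hW : ∀ x ∈ W, ∃ a c : ℂ, x = a • b1 + c • b2) (h1 : e1 ∈ W) (h2 : e2 ∈ W)
    (n1 : ‖e1‖ = 1) (n2 : ‖e2‖ = 1) (ho : inner ℂ e1 e2 = 0) :
    ∀ x ∈ W, ∃ a c : ℂ, x = a • e1 + c • e2 := by
  have hle : Submodule.span ℂ {e1, e2} ≤ W := by
    rw [Submodule.span_le]
    rintro x (rfl | rfl)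
    · exact h1
    · exact h2
  have hle2 : W ≤ Submodule.span ℂ {b1, b2} := by
    intro x hx
    obtain ⟨a, c, rfl⟩ := hW x hx
    exact Submodule.mem_span_pair.2 ⟨a, c, rfl⟩
  have hon : Orthonormal ℂ ![e1, e2] := by
    constructor
    · intro i; fin_cases i <;> simp [n1, n2]
    · intro i j hij
      fin_cases i <;> fin_cases j
      · exact absurd rfl hij
      · simpa using ho
      · have : inner ℂ e2 e1 = 0 := by rw [← inner_conj_symm, ho]; simp
        simpa using this
      · exact absurd rfl hij
  have hrank : Module.finrank ℂ (Submodule.span ℂ {e1, e2}) = 2 := by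
    have := finrank_span_eq_card hon.linearIndependent
    have hr : Set.range ![e1, e2] = {e1, e2} := by
      ext x; simp [eq_comm]; exact or_comm
    rw [hr] at this
    simpa using this
  have hrank2 : Module.finrank ℂ W ≤ 2 := by
    refine (Submodule.finrank_mono hle2).trans ?_
    classical
    have := finrank_span_finset_le_card (R := ℂ) ({b1, b2} : Finset V)
    rw [Set.finrank, Finset.coe_pair] at this
    exact this.trans Finset.card_le_two
  have heq := Submodule.eq_of_le_of_finrank_le hle (by rw [hrank]; exact hrank2)
  intro x hx
  rw [← heq] at hx
  obtain ⟨a, c, h⟩ := Submodule.mem_span_pair.1 hx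
  exact ⟨a, c, h.symm⟩

theorem DiagBy.eig_span {T0 : V →L[ℂ] V} {b : OrthonormalBasis (Fin n) ℂ V} {μ : Fin n → ℝ}
    (h : DiagBy T0 b μ) {j k : Fin n} (hjk : ∀ l, μ l = μ j ↔ (l = j ∨ l = k)) (hne : j ≠ k)
    {x : V} (hx : T0 x = (μ j : ℂ) • x) : ∃ a c : ℂ, x = a • b j + c • b k := by
  refine ⟨inner ℂ (b j) x, inner ℂ (b k) x, ?_⟩
  apply onb_ext b
  intro i
  rw [inner_add_right, inner_smul_right, inner_smul_right]
  by_cases hi : μ i = μ j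
  · rcases (hjk i).1 hi with rfl | rfl
    · simp [b.inner_eq_zero hne]
    · simp [b.inner_eq_zero hne.symm]
  · have h1 := h.inner_apply i x
    rw [hx, inner_smul_right] at h1
    have h3 : ((μ i : ℂ) - μ j) * inner ℂ (b i) x = 0 := by rw [sub_mul, h1, sub_self]
    have h2 : ((μ i : ℂ) - μ j) ≠ 0 := by
      rw [← Complex.ofReal_sub, Complex.ofReal_ne_zero]; exact sub_ne_zero.2 hi
    have h4 := (mul_eq_zero.1 h3).resolve_left h2
    have h5 : i ≠ j := by rintro rfl; exact hi rfl
    have h6 : i ≠ k := by rintro rfl; exact hi ((hjk i).2 (Or.inr rfl))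
    rw [h4, b.inner_eq_zero h5, b.inner_eq_zero h6]; simp

end PartC2

section PartC3

variable {V : Type} [NormedAddCommGroup V] [InnerProductSpace ℂ V] [FiniteDimensional ℂ V]
  {n m : ℕ}

/-- affine family of symmetric operators with an ordered spectrum -/
structure SpecFam (U : Set (EuclideanSpace ℝ (Fin m))) (T : EuclideanSpace ℝ (Fin m) → V →L[ℂ] V)
    (D : EuclideanSpace ℝ (Fin m) →ₗ[ℝ] (V →L[ℂ] V))
    (lam : EuclideanSpace ℝ (Fin m) → Fin n → ℝ) : Prop where
  op : IsOpen U
  aff : ∀ u v (t : ℝ), T (u + t • v) = T u + (t : ℂ) • D v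
  symT : ∀ u x y, inner ℂ (T u x) y = inner ℂ x (T u y)
  symD : ∀ u x y, inner ℂ (D u x) y = inner ℂ x (D u y)
  cont : Continuous T
  spec : ∀ u ∈ U, Monotone (lam u) ∧
    ∃ b : OrthonormalBasis (Fin n) ℂ V, DiagBy (T u) b (lam u)

variable {U : Set (EuclideanSpace ℝ (Fin m))} {T : EuclideanSpace ℝ (Fin m) → V →L[ℂ] V}
  {D : EuclideanSpace ℝ (Fin m) →ₗ[ℝ] (V →L[ℂ] V)} {lam : EuclideanSpace ℝ (Fin m) → Fin n → ℝ}

theorem open_ray (hU : IsOpen U) {u : EuclideanSpace ℝ (Fin m)} (hu : u ∈ U)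
    (v : EuclideanSpace ℝ (Fin m)) : ∃ ε > (0 : ℝ), ∀ t : ℝ, 0 < t → t < ε → u + t • v ∈ U := by
  have hcont : ContinuousAt (fun t : ℝ => u + t • v) 0 := by fun_prop
  have := hcont.preimage_mem_nhds (hU.mem_nhds (by simpa using hu))
  obtain ⟨ε, hε, h⟩ := Metric.mem_nhds_iff.1 this
  refine ⟨ε, hε, fun t ht0 htε => h ?_⟩
  rw [Metric.mem_ball, Real.dist_eq, sub_zero, abs_of_pos ht0]
  exact htε

theorem SpecFam.conical_dir (F : SpecFam U T D lam) {j k : Fin n}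
    {u : EuclideanSpace ℝ (Fin m)} (hc : ConicalAt U lam j k u)
    {v : EuclideanSpace ℝ (Fin m)} (hv : v ≠ 0) {e1 e2 : V}
    (h1 : T u e1 = (lam u j : ℂ) • e1) (h2 : T u e2 = (lam u j : ℂ) • e2)
    (n1 : ‖e1‖ = 1) (n2 : ‖e2‖ = 1) (ho : inner ℂ e1 e2 = 0)
    (hd : inner ℂ e1 (D v e2) = 0) (hdd : inner ℂ e1 (D v e1) = inner ℂ e2 (D v e2)) : False := by
  obtain ⟨huU, hlamjk, hmult, c, hc0, hgap⟩ := hc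
  set s : ℝ := ‖v‖⁻¹ with hs
  have hs0 : s ≠ 0 := inv_ne_zero (norm_ne_zero_iff.2 hv)
  have hv' : ‖s • v‖ = 1 := by
    rw [norm_smul, hs, norm_inv, norm_norm, inv_mul_cancel₀ (norm_ne_zero_iff.2 hv)]
  have hDs : ∀ x, D (s • v) x = (s : ℂ) • D v x := by
    intro x; rw [map_smul]; simp
  obtain ⟨ε1, hε1, hg⟩ := hgap _ hv'
  obtain ⟨ε2, hε2, hU2⟩ := open_ray F.op huU (s • v)
  obtain ⟨hmono, b, hb⟩ := F.spec u huU
  have hne : j ≠ k := by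
    rintro rfl
    have := hg (ε1 / 2) (by linarith) (by linarith)
    have h2 : 0 < c * (ε1 / 2) := by positivity
    linarith
  have hreal : inner ℂ e1 (D (s • v) e1) = (((inner ℂ e1 (D (s • v) e1)).re : ℝ) : ℂ) := by
    rw [eq_comm, ← Complex.conj_eq_iff_re, inner_conj_symm, F.symD]
  set β := (inner ℂ e1 (D (s • v) e1)).re with hβ
  have hd' : inner ℂ e1 (D (s • v) e2) = 0 := by rw [hDs, inner_smul_right, hd, mul_zero]
  have hd'' : inner ℂ e2 (D (s • v) e1) = 0 := by
    rw [← F.symD, ← inner_conj_symm, hd', map_zero]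
  have hdd' : inner ℂ e2 (D (s • v) e2) = (β : ℂ) := by
    rw [← hreal, hDs, inner_smul_right, ← hdd, hDs, inner_smul_right]
  have ho' : inner ℂ e2 e1 = 0 := by rw [← inner_conj_symm, ho, map_zero]
  have h11 : inner ℂ e1 e1 = 1 := by rw [inner_self_eq_norm_sq_to_K, n1]; simp
  have h22 : inner ℂ e2 e2 = 1 := by rw [inner_self_eq_norm_sq_to_K, n2]; simp
  have hspan : ∀ x, T u x = (lam u j : ℂ) • x → ∃ a c : ℂ, x = a • e1 + c • e2 := by
    intro x hx
    let W : Submodule ℂ V := LinearMap.ker ((T u : V →ₗ[ℂ] V) - (lam u j : ℂ) • LinearMap.id)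
    have hWm : ∀ x, x ∈ W ↔ T u x = (lam u j : ℂ) • x := by
      intro x
      simp [W, LinearMap.mem_ker, sub_eq_zero]
    exact span_pair_eq (W := W) (fun x hx => hb.eig_span hmult hne ((hWm x).1 hx))
      ((hWm _).2 h1) ((hWm _).2 h2) n1 n2 ho x ((hWm x).2 hx)
  refine gap_contra hb hmono hmult (ε := min ε1 ε2) (lt_min hε1 hε2) hc0
    (lamt := fun t => lam (u + t • (s • v))) (D := D (s • v)) ?_ ?_ β ?_
  · intro t ht0 ht
    rw [← F.aff]
    exact F.spec _ (hU2 t ht0 (ht.trans_le (min_le_right _ _)))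
  · intro t ht0 ht
    exact hg t ht0 (ht.trans_le (min_le_left _ _))
  · intro x y hx hy
    obtain ⟨a, c, rfl⟩ := hspan x hx
    obtain ⟨a', c', rfl⟩ := hspan y hy
    clear_value β
    generalize D (s • v) = D' at hd' hd'' hdd' hreal ⊢
    simp only [map_add, map_smul, inner_add_left, inner_add_right, inner_smul_left,
      inner_smul_right, hd', hd'', hdd', hreal, h11, h22, ho, ho']
    ring

theorem SpecFam.D_mem (F : SpecFam U T D lam) {K : Submodule ℝ V} {u : EuclideanSpace ℝ (Fin m)}
    (hu : u ∈ U) {w : V} (h : ∀ u ∈ U, T u w ∈ K) (v : EuclideanSpace ℝ (Fin m)) : D v w ∈ K := by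
  obtain ⟨ε, hε, hU⟩ := open_ray F.op hu v
  have h1 := h _ (hU (ε / 2) (by linarith) (by linarith))
  have h2 := K.sub_mem h1 (h u hu)
  rw [F.aff, add_apply, add_sub_cancel_left, smul_apply, Complex.coe_smul] at h2
  have h3 := K.smul_mem (ε / 2)⁻¹ h2
  rwa [smul_smul, inv_mul_cancel₀ (by positivity), one_smul] at h3

/-- there is a nonzero direction in the kernel of any real functional -/
theorem exists_dir (hm : 2 ≤ m) (f : EuclideanSpace ℝ (Fin m) →ₗ[ℝ] ℝ) : ∃ v, v ≠ 0 ∧ f v = 0 := by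
  by_contra hno
  push Not at hno
  have hinj : Function.Injective f := by
    rw [← LinearMap.ker_eq_bot, Submodule.eq_bot_iff]
    intro x hx
    by_contra h0
    exact hno x h0 hx
  have := LinearMap.finrank_le_finrank_of_injective hinj
  simp at this
  omega

end PartC3

section PartC4

variable {V : Type} [NormedAddCommGroup V] [InnerProductSpace ℂ V] [FiniteDimensional ℂ V]
  {n m : ℕ}

variable {U : Set (EuclideanSpace ℝ (Fin m))} {T : EuclideanSpace ℝ (Fin m) → V →L[ℂ] V}
  {D : EuclideanSpace ℝ (Fin m) →ₗ[ℝ] (V →L[ℂ] V)} {lam : EuclideanSpace ℝ (Fin m) → Fin n → ℝ}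

/-- the eigenspace at `lam u l` meets `W` -/
def Meets (T : EuclideanSpace ℝ (Fin m) → V →L[ℂ] V) (lam : EuclideanSpace ℝ (Fin m) → Fin n → ℝ)
    (W : Submodule ℂ V) (u : EuclideanSpace ℝ (Fin m)) (l : Fin n) : Prop :=
  ∃ w ∈ W, ‖w‖ = 1 ∧ T u w = (lam u l : ℂ) • w

theorem Meets.of_ne {W : Submodule ℂ V} {u : EuclideanSpace ℝ (Fin m)} {l : Fin n} {w : V}
    (hw : w ∈ W) (h0 : w ≠ 0) (h : T u w = (lam u l : ℂ) • w) : Meets T lam W u l := by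
  refine ⟨((‖w‖⁻¹ : ℝ) : ℂ) • w, W.smul_mem _ hw, ?_, ?_⟩
  · rw [norm_smul, Complex.norm_real, norm_inv, norm_norm, inv_mul_cancel₀ (norm_ne_zero_iff.2 h0)]
  · rw [map_smul, h, smul_comm]

theorem SpecFam.orth_inv (F : SpecFam U T D lam) {W : Submodule ℂ V}
    {u : EuclideanSpace ℝ (Fin m)} (hW : ∀ w ∈ W, T u w ∈ W) : ∀ w ∈ Wᗮ, T u w ∈ Wᗮ := by
  intro w hw
  rw [Submodule.mem_orthogonal] at hw ⊢
  intro x hx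
  rw [← F.symT]
  exact hw _ (hW x hx)

theorem SpecFam.split (F : SpecFam U T D lam) {W : Submodule ℂ V}
    {u : EuclideanSpace ℝ (Fin m)} (hW : ∀ w ∈ W, T u w ∈ W) {l : Fin n} {x : V}
    (hx : T u x = (lam u l : ℂ) • x) :
    ∃ p ∈ W, ∃ q ∈ Wᗮ, x = p + q ∧ T u p = (lam u l : ℂ) • p ∧ T u q = (lam u l : ℂ) • q := by
  obtain ⟨p, hp, hq⟩ := Submodule.HasOrthogonalProjection.exists_orthogonal (K := W) x
  have e1 : T u p - (lam u l : ℂ) • p ∈ W := W.sub_mem (hW p hp) (W.smul_mem _ hp)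
  have e2 : T u (x - p) - (lam u l : ℂ) • (x - p) ∈ Wᗮ :=
    Wᗮ.sub_mem (F.orth_inv hW _ hq) (Wᗮ.smul_mem _ hq)
  have e3 : T u (x - p) - (lam u l : ℂ) • (x - p) = -(T u p - (lam u l : ℂ) • p) := by
    rw [map_sub, hx]; module
  have e4 : T u p - (lam u l : ℂ) • p = 0 := by
    rw [e3] at e2
    have := (Submodule.mem_orthogonal _ _).1 e2 _ e1
    rw [inner_neg_right, neg_eq_zero] at this
    exact inner_self_eq_zero.1 this
  refine ⟨p, hp, x - p, hq, by abel, sub_eq_zero.1 e4, ?_⟩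
  rw [e4, neg_zero] at e3
  exact sub_eq_zero.1 e3

theorem SpecFam.cover (F : SpecFam U T D lam) {W : Submodule ℂ V}
    {u : EuclideanSpace ℝ (Fin m)} (hu : u ∈ U) (hW : ∀ w ∈ W, T u w ∈ W) (l : Fin n) :
    Meets T lam W u l ∨ Meets T lam Wᗮ u l := by
  obtain ⟨_, b, hb⟩ := F.spec u hu
  obtain ⟨p, hp, q, hq, hpq, h1, h2⟩ := F.split hW (hb l)
  by_cases hp0 : p = 0
  · right
    refine Meets.of_ne hq ?_ h2
    rintro rfl
    rw [hp0, add_zero] at hpq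
    exact b.toBasis.ne_zero l (by simpa using hpq)
  · exact Or.inl (Meets.of_ne hp hp0 h1)

theorem SpecFam.not_both (F : SpecFam U T D lam) (hm : 2 ≤ m)
    (hcc : ConicallyConnected U lam) {W : Submodule ℂ V}
    (hW : ∀ u ∈ U, ∀ w ∈ W, T u w ∈ W) {u : EuclideanSpace ℝ (Fin m)} (hu : u ∈ U) (l : Fin n)
    (h1 : Meets T lam W u l) (h2 : Meets T lam Wᗮ u l) : False := by
  obtain ⟨e1, he1, n1, t1⟩ := h1
  obtain ⟨e2, he2, n2, t2⟩ := h2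
  have ho : inner ℂ e1 e2 = 0 := (Submodule.mem_orthogonal _ _).1 he2 _ he1
  obtain ⟨hmono, b, hb⟩ := F.spec u hu
  -- a second index with the same eigenvalue
  have hex : ∃ l', l' ≠ l ∧ lam u l' = lam u l := by
    by_contra hno
    push Not at hno
    have hz : ∀ x, T u x = (lam u l : ℂ) • x → x = inner ℂ (b l) x • b l := by
      intro x hx
      apply onb_ext b
      intro i
      rw [inner_smul_right]
      by_cases hi : i = l
      · rw [hi, b.inner_eq_one, mul_one]
      · have h1 := hb.inner_apply i x
        rw [hx, inner_smul_right] at h1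
        have h3 : ((lam u i : ℂ) - lam u l) * inner ℂ (b i) x = 0 := by rw [sub_mul, h1, sub_self]
        have h2 : ((lam u i : ℂ) - lam u l) ≠ 0 := by
          rw [← Complex.ofReal_sub, Complex.ofReal_ne_zero]; exact sub_ne_zero.2 (hno i hi)
        rw [(mul_eq_zero.1 h3).resolve_left h2, b.inner_eq_zero hi, mul_zero]
    have z1 := hz e1 t1
    have z2 := hz e2 t2
    rw [z1, z2, inner_smul_left, inner_smul_right, b.inner_eq_one, mul_one, mul_eq_zero] at ho
    rcases ho with h | h
    · rw [map_eq_zero] at h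
      rw [h, zero_smul] at z1
      rw [z1] at n1; simp at n1
    · rw [h, zero_smul] at z2
      rw [z2] at n2; simp at n2
  have hadj : ∃ j k : Fin n, (j : ℕ) + 1 = k ∧ lam u j = lam u k ∧ lam u j = lam u l := by
    obtain ⟨l', hne, heq⟩ := hex
    have gen : ∀ p q : Fin n, p < q → lam u p = lam u q →
        ∃ j k : Fin n, (j : ℕ) + 1 = k ∧ lam u j = lam u k ∧ lam u j = lam u p := by
      intro p q hpq he
      have hlt : (p : ℕ) + 1 < n := by have := q.2; have : (p : ℕ) < q := hpq; omega
      refine ⟨p, ⟨p + 1, hlt⟩, rfl, ?_, rfl⟩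
      apply le_antisymm
      · exact hmono (by rw [Fin.le_def]; simp)
      · rw [he]
        exact hmono (by rw [Fin.le_def]; exact hpq)
    rcases lt_or_gt_of_ne hne with h | h
    · obtain ⟨j, k, hjk, h1, h2⟩ := gen _ _ h heq
      exact ⟨j, k, hjk, h1, h2.trans heq⟩
    · exact gen _ _ h heq.symm
  obtain ⟨j, k, hjk, hl1, hl2⟩ := hadj
  have hc := hcc.1 u hu j k hjk hl1
  let f : EuclideanSpace ℝ (Fin m) →ₗ[ℝ] ℝ :=
    { toFun := fun v => (inner ℂ e1 (D v e1) - inner ℂ e2 (D v e2)).re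
      map_add' := by
        intro x y
        simp only [map_add, add_apply, inner_add_right, Complex.sub_re, Complex.add_re]
        ring
      map_smul' := by
        intro c x
        simp only [map_smul, smul_apply, ← Complex.coe_smul, inner_smul_right, ← mul_sub,
          Complex.re_ofReal_mul, RingHom.id_apply, smul_eq_mul] }
  obtain ⟨v, hv, hfv⟩ := exists_dir hm f
  have hDW : ∀ w ∈ W, D v w ∈ W := fun w hw =>
    F.D_mem (K := W.restrictScalars ℝ) hu (fun u hu => hW u hu w hw) v
  have hDW2 : D v e2 ∈ Wᗮ :=
    F.D_mem (K := Wᗮ.restrictScalars ℝ) hu (fun u hu => F.orth_inv (hW u hu) e2 he2) v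
  have hre : ∀ e, inner ℂ e (D v e) = (((inner ℂ e (D v e)).re : ℝ) : ℂ) := by
    intro e
    rw [eq_comm, ← Complex.conj_eq_iff_re, inner_conj_symm, F.symD]
  refine F.conical_dir hc hv (e1 := e1) (e2 := e2) (by rw [t1, hl2]) (by rw [t2, hl2]) n1 n2 ho
    ((Submodule.mem_orthogonal _ _).1 hDW2 _ he1) ?_
  rw [hre e1, hre e2]
  have : (inner ℂ e1 (D v e1) - inner ℂ e2 (D v e2)).re = 0 := hfv
  rw [Complex.sub_re, sub_eq_zero] at this
  rw [this]

theorem SpecFam.closed_meets (F : SpecFam U T D lam) {W : Submodule ℂ V} {l : Fin n}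
    {u : EuclideanSpace ℝ (Fin m)} (hu : u ∈ U)
    (hcl : u ∈ closure {u ∈ U | Meets T lam W u l}) : Meets T lam W u l := by
  obtain ⟨us, hus, hlim⟩ := mem_closure_iff_seq_limit.1 hcl
  choose husU w hwW hwn hw using hus
  have hcomp : IsCompact (Metric.sphere (0 : V) 1) := by
    have : ProperSpace V := FiniteDimensional.proper ℂ V
    exact isCompact_sphere 0 1
  obtain ⟨w0, hw0, φ, hφ, hlw⟩ := hcomp.tendsto_subseq (x := w) (fun k => by simp [hwn k])
  have hlu : Filter.Tendsto (us ∘ φ) Filter.atTop (nhds u) := hlim.comp hφ.tendsto_atTop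
  obtain ⟨hmono, b, hb⟩ := F.spec u hu
  have hT : Filter.Tendsto (fun k => T (us (φ k))) Filter.atTop (nhds (T u)) :=
    (F.cont.tendsto u).comp hlu
  have hlam : Filter.Tendsto (fun k => lam (us (φ k)) l) Filter.atTop (nhds (lam u l)) := by
    rw [tendsto_iff_dist_tendsto_zero]
    have h0 : Filter.Tendsto (fun k => ‖T (us (φ k)) - T u‖) Filter.atTop (nhds 0) :=
      tendsto_iff_norm_sub_tendsto_zero.1 hT
    refine squeeze_zero (fun k => dist_nonneg) (fun k => ?_) h0
    obtain ⟨hmono', b', hb'⟩ := F.spec _ (husU (φ k))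
    rw [Real.dist_eq]
    exact weyl hb hb' hmono hmono' l
  refine ⟨w0, ?_, by simpa using hw0, ?_⟩
  · have hc : IsClosed (W : Set V) := W.closed_of_finiteDimensional
    exact hc.mem_of_tendsto hlw (Filter.Eventually.of_forall fun k => hwW (φ k))
  · have c1 : Filter.Tendsto (fun k => T (us (φ k)) (w (φ k))) Filter.atTop (nhds (T u w0)) :=
      (isBoundedBilinearMap_apply.continuous.tendsto (T u, w0)).comp (hT.prodMk_nhds hlw)
    have c2 : Filter.Tendsto (fun k => (lam (us (φ k)) l : ℂ) • w (φ k)) Filter.atTop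
        (nhds ((lam u l : ℂ) • w0)) :=
      ((Complex.continuous_ofReal.tendsto _).comp hlam).smul hlw
    refine tendsto_nhds_unique c1 ?_
    simpa only [hw] using c2

theorem SpecFam.irr (F : SpecFam U T D lam) (hm : 2 ≤ m) (hconn : IsConnected U)
    (hcc : ConicallyConnected U lam) (W : Submodule ℂ V)
    (hW : ∀ u ∈ U, ∀ w ∈ W, T u w ∈ W) (hbot : W ≠ ⊥) : W = ⊤ := by
  have hconst : ∀ l, ∀ u ∈ U, ∀ u' ∈ U, Meets T lam W u l → Meets T lam W u' l := by
    intro l u hu u' hu' hM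
    by_contra hM'
    have hM2 := (F.cover hu' (hW u' hu') l).resolve_left hM'
    obtain ⟨x, hxU, hx1, hx2⟩ := isPreconnected_closed_iff.1 hconn.isPreconnected
      (closure {u ∈ U | Meets T lam W u l}) (closure {u ∈ U | Meets T lam Wᗮ u l})
      isClosed_closure isClosed_closure
      (fun y hy => by
        rcases F.cover hy (hW y hy) l with h | h
        · exact Or.inl (subset_closure ⟨hy, h⟩)
        · exact Or.inr (subset_closure ⟨hy, h⟩))
      ⟨u, hu, subset_closure ⟨hu, hM⟩⟩ ⟨u', hu', subset_closure ⟨hu', hM2⟩⟩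
    exact F.not_both hm hcc hW hxU l (F.closed_meets hxU hx1) (F.closed_meets hxU hx2)
  have hadj : ∀ j k : Fin n, (j : ℕ) + 1 = k → ∀ u ∈ U,
      (Meets T lam W u j ↔ Meets T lam W u k) := by
    intro j k hjk u hu
    obtain ⟨ub, hc, _⟩ := hcc.2 j k hjk
    have hub : ub ∈ U := hc.1
    have he : Meets T lam W ub j ↔ Meets T lam W ub k := by
      unfold Meets; rw [hc.2.1]
    constructor
    · intro h; exact hconst k ub hub u hu (he.1 (hconst j u hu ub hub h))
    · intro h; exact hconst j ub hub u hu (he.2 (hconst k u hu ub hub h))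
  obtain ⟨u, hu⟩ := hconn.nonempty
  obtain ⟨_, b, hb⟩ := F.spec u hu
  have hall : ∀ (k : ℕ) (hk : k < n), (Meets T lam W u ⟨k, hk⟩ ↔
      Meets T lam W u ⟨0, by omega⟩) := by
    intro k
    induction k with
    | zero => intro _; rfl
    | succ k ih =>
      intro hk
      rw [← ih (by omega)]
      exact (hadj ⟨k, by omega⟩ ⟨k + 1, hk⟩ rfl u hu).symm
  by_cases h0 : ∀ l, Meets T lam W u l
  · rw [eq_top_iff, ← b.toBasis.span_eq, Submodule.span_le]
    rintro _ ⟨l, rfl⟩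
    obtain ⟨p, hp, q, hq, hpq, t1, t2⟩ := F.split (hW u hu) (hb l)
    by_cases hq0 : q = 0
    · rw [hq0, add_zero] at hpq
      simpa [hpq] using hp
    · exact (F.not_both hm hcc hW hu l (h0 l) (Meets.of_ne hq hq0 t2)).elim
  · exfalso
    push Not at h0
    obtain ⟨l0, hl0⟩ := h0
    have hnone : ∀ l, ¬ Meets T lam W u l := by
      intro l hl
      exact hl0 ((hall l0 l0.2).2 ((hall l l.2).1 hl))
    apply hbot
    have htop : Wᗮ = ⊤ := by
      rw [eq_top_iff, ← b.toBasis.span_eq, Submodule.span_le]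
      rintro _ ⟨l, rfl⟩
      obtain ⟨p, hp, q, hq, hpq, t1, t2⟩ := F.split (hW u hu) (hb l)
      by_cases hp0 : p = 0
      · rw [hp0, zero_add] at hpq
        simpa [hpq] using hq
      · exact (hnone l (Meets.of_ne hp hp0 t1)).elim
    exact (Submodule.orthogonal_eq_top_iff _).1 htop

end PartC4

section PartC5

variable {V : Type} [NormedAddCommGroup V] [InnerProductSpace ℂ V] [FiniteDimensional ℂ V]
  {n m : ℕ}

theorem clm_onb_ext (b : OrthonormalBasis (Fin n) ℂ V) {A B : V →L[ℂ] V}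
    (h : ∀ i, A (b i) = B (b i)) : A = B := by
  have : (A : V →ₗ[ℂ] V) = (B : V →ₗ[ℂ] V) := b.toBasis.ext (fun i => by simpa using h i)
  ext x
  exact LinearMap.congr_fun this x

/-- the averaged (block diagonal) part of an element of a bracket-closed space stays in it -/
theorem block_part {L : Submodule ℝ (V →L[ℂ] V)} (hL : ∀ A ∈ L, ∀ B ∈ L, B * A - A * B ∈ L)
    {b : OrthonormalBasis (Fin n) ℂ V} {mu : Fin n → ℝ} {X : V →L[ℂ] V} (hX : X ∈ L)
    (hsk : IsSkew X) (hXb : ∀ l, X (b l) = (-Complex.I * (mu l : ℂ)) • b l)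
    {Z : V →L[ℂ] V} (hZ : Z ∈ L) :
    ∃ A ∈ L, (∀ p q, mu p ≠ mu q → inner ℂ (b p) (A (b q)) = 0) ∧
      (∀ p q, mu p = mu q → inner ℂ (b p) (A (b q)) = inner ℂ (b p) (Z (b q))) := by
  haveI : FiniteDimensional ℝ (V →L[ℂ] V) := finDim_op_real
  have hmat : ∀ (Y : V →L[ℂ] V) p q, inner ℂ (b p) ((X * Y - Y * X) (b q)) =
      -Complex.I * ((mu p : ℂ) - mu q) * inner ℂ (b p) (Y (b q)) := by
    intro Y p q
    have h1 : inner ℂ (b p) (X (Y (b q))) = -(inner ℂ (X (b p)) (Y (b q))) := by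
      rw [hsk, neg_neg]
    rw [sub_apply, mul_apply_eq_comp, mul_apply_eq_comp, inner_sub_right, h1, hXb, hXb, map_smul,
      inner_smul_left, inner_smul_right]
    simp only [map_mul, map_neg, Complex.conj_I, Complex.conj_ofReal]
    ring
  let ad : L →ₗ[ℝ] L :=
    { toFun := fun Y => ⟨X * Y.1 - Y.1 * X, hL _ Y.2 _ hX⟩
      map_add' := by
        intro x y; apply Subtype.ext
        simp only [Submodule.coe_add, mul_add, add_mul]; abel
      map_smul' := by
        intro r x; apply Subtype.ext
        simp only [Submodule.coe_smul, RingHom.id_apply, mul_smul_comm, smul_mul_assoc, smul_sub] }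
  have hadv : ∀ Y : L, (ad Y : V →L[ℂ] V) = X * Y.1 - Y.1 * X := fun _ => rfl
  have hker : ∀ Y : L, ad Y = 0 → ∀ p q, mu p ≠ mu q → inner ℂ (b p) (Y.1 (b q)) = 0 := by
    intro Y hY p q hpq
    have h0 : X * Y.1 - Y.1 * X = 0 := by rw [← hadv, hY]; rfl
    have h := hmat Y.1 p q
    rw [h0] at h
    simp only [zero_apply, inner_zero_right] at h
    rcases mul_eq_zero.1 h.symm with h | h
    · rcases mul_eq_zero.1 h with h | h
      · simp at h
      · exact absurd (by exact_mod_cast sub_eq_zero.1 h) hpq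
    · exact h
  have hran : ∀ Y : L, ∀ p q, mu p = mu q → inner ℂ (b p) ((ad Y).1 (b q)) = 0 := by
    intro Y p q hpq
    rw [hadv, hmat, hpq]; simp
  have hdisj : Disjoint (LinearMap.range ad) (LinearMap.ker ad) := by
    rw [Submodule.disjoint_def]
    rintro _ ⟨Y, rfl⟩ hY
    apply Subtype.ext
    apply clm_onb_ext b
    intro q
    apply onb_ext b
    intro p
    simp only [ZeroMemClass.coe_zero, zero_apply, inner_zero_right]
    by_cases hpq : mu p = mu q
    · exact hran Y p q hpq
    · exact hker _ hY p q hpq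
  have htop : LinearMap.range ad ⊔ LinearMap.ker ad = ⊤ :=
    Submodule.eq_top_of_disjoint _ _ (LinearMap.finrank_range_add_finrank_ker ad).ge hdisj
  have hZ' : (⟨Z, hZ⟩ : L) ∈ LinearMap.range ad ⊔ LinearMap.ker ad := by rw [htop]; trivial
  obtain ⟨_, ⟨Y, rfl⟩, A, hA, hsum⟩ := Submodule.mem_sup.1 hZ'
  refine ⟨A.1, A.2, hker A hA, ?_⟩
  intro p q hpq
  have hsum' : (ad Y).1 + A.1 = Z := congrArg Subtype.val hsum
  rw [← hsum', add_apply, inner_add_right, hran Y p q hpq, zero_add]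

/-- block form: scalar plus `su(2)` part on the plane, diagonal elsewhere -/
def BlkForm (b : OrthonormalBasis (Fin n) ℂ V) (j k : Fin n) (A : V →L[ℂ] V)
    (a1 a2 a3 : ℝ) : Prop :=
  ∃ (τ : ℝ) (d : Fin n → ℂ),
    A (b j) = (Complex.I * (τ + a3)) • b j + (-(a1 : ℂ) + Complex.I * a2) • b k ∧
    A (b k) = ((a1 : ℂ) + Complex.I * a2) • b j + (Complex.I * (τ - a3)) • b k ∧
    ∀ q, q ≠ j → q ≠ k → A (b q) = d q • b q

/-- general element of `su(2)` on a plane -/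
noncomputable def cS (e1 e2 : V) (w1 w2 w3 : ℝ) : V →L[ℂ] V :=
  w1 • cS1 e1 e2 + w2 • cS2 e1 e2 + w3 • cS3 e1 e2

theorem onb_inner (b : OrthonormalBasis (Fin n) ℂ V) (i j : Fin n) :
    inner ℂ (b i) (b j) = if i = j then (1 : ℂ) else 0 :=
  orthonormal_iff_ite.1 b.orthonormal i j

theorem cS_blk (b : OrthonormalBasis (Fin n) ℂ V) {j k : Fin n} (hjk : j ≠ k) (w1 w2 w3 : ℝ) :
    cS (b j) (b k) w1 w2 w3 (b j) = (Complex.I * w3) • b j + (-(w1 : ℂ) + Complex.I * w2) • b k ∧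
    cS (b j) (b k) w1 w2 w3 (b k) = ((w1 : ℂ) + Complex.I * w2) • b j + (-Complex.I * w3) • b k ∧
    ∀ q, q ≠ j → q ≠ k → cS (b j) (b k) w1 w2 w3 (b q) = 0 := by
  refine ⟨?_, ?_, ?_⟩
  · simp only [cS, add_apply, smul_apply, cS1_apply, cS2_apply, cS3_apply, onb_inner, hjk,
      hjk.symm, if_true, if_false, ← Complex.coe_smul]
    module
  · simp only [cS, add_apply, smul_apply, cS1_apply, cS2_apply, cS3_apply, onb_inner, hjk,
      hjk.symm, if_true, if_false, ← Complex.coe_smul]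
    module
  · intro q h1 h2
    simp only [cS, add_apply, smul_apply, cS1_apply, cS2_apply, cS3_apply, onb_inner, h1.symm,
      h2.symm, if_false, ← Complex.coe_smul]
    module

theorem cS_form (b : OrthonormalBasis (Fin n) ℂ V) {j k : Fin n} (hjk : j ≠ k) (w1 w2 w3 : ℝ) :
    BlkForm b j k (cS (b j) (b k) w1 w2 w3) w1 w2 w3 := by
  obtain ⟨h1, h2, h3⟩ := cS_blk b hjk w1 w2 w3
  refine ⟨0, 0, ?_, ?_, ?_⟩
  · rw [h1]; push_cast; module
  · rw [h2]; push_cast; module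
  · intro q hq hq'; rw [h3 q hq hq']; simp

theorem BlkForm.bracket {b : OrthonormalBasis (Fin n) ℂ V} {j k : Fin n} (hjk : j ≠ k)
    {A B : V →L[ℂ] V} {a1 a2 a3 b1 b2 b3 : ℝ} (hA : BlkForm b j k A a1 a2 a3)
    (hB : BlkForm b j k B b1 b2 b3) :
    A * B - B * A = cS (b j) (b k) (2 * (a2 * b3 - a3 * b2)) (2 * (a3 * b1 - a1 * b3))
      (2 * (a1 * b2 - a2 * b1)) := by
  obtain ⟨s, d, A1, A2, A3⟩ := hA
  obtain ⟨t, d', B1, B2, B3⟩ := hB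
  obtain ⟨C1, C2, C3⟩ := cS_blk b hjk (2 * (a2 * b3 - a3 * b2)) (2 * (a3 * b1 - a1 * b3))
      (2 * (a1 * b2 - a2 * b1))
  apply clm_onb_ext b
  intro q
  rw [sub_apply, mul_apply_eq_comp, mul_apply_eq_comp]
  by_cases hq : q = j
  · subst hq
    rw [A1, B1, C1, map_add, map_add]
    simp only [map_smul, A1, A2, B1, B2]
    push_cast
    match_scalars
    · linear_combination (2 * (a1 * b2 - a2 * b1 : ℂ) * Complex.I) * 0
    · ring_nf; simp only [Complex.I_sq]; ring
  by_cases hq' : q = k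
  · subst hq'
    rw [A2, B2, C2, map_add, map_add]
    simp only [map_smul, A1, A2, B1, B2]
    push_cast
    match_scalars
    · ring_nf; simp only [Complex.I_sq]; ring
    · ring_nf
  · rw [A3 q hq hq', B3 q hq hq', C3 q hq hq', map_smul, map_smul, A3 q hq hq', B3 q hq hq']
    module

end PartC5

section PartC6

variable {V : Type} [NormedAddCommGroup V] [InnerProductSpace ℂ V] [FiniteDimensional ℂ V]
  {n m : ℕ}

theorem BlkForm.of_zeros {b : OrthonormalBasis (Fin n) ℂ V} {j k : Fin n} (hjk : j ≠ k)
    {mu : Fin n → ℝ} {A : V →L[ℂ] V} (hsk : IsSkew A)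
    (hz : ∀ p q, mu p ≠ mu q → inner ℂ (b p) (A (b q)) = 0)
    (hm1 : ∀ l, mu l = mu j ↔ (l = j ∨ l = k))
    (hm2 : ∀ l, l ≠ j → l ≠ k → ∀ l', mu l' = mu l → l' = l) :
    BlkForm b j k A (inner ℂ (b j) (A (b k))).re (inner ℂ (b j) (A (b k))).im
      (((inner ℂ (b j) (A (b j))).im - (inner ℂ (b k) (A (b k))).im) / 2) := by
  have hkj : mu k = mu j := (hm1 k).2 (Or.inr rfl)
  have hdiag : ∀ q, inner ℂ (b q) (A (b q)) = Complex.I * ((inner ℂ (b q) (A (b q))).im : ℂ) := by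
    intro q
    have h1 : (starRingEnd ℂ) (inner ℂ (b q) (A (b q))) = - inner ℂ (b q) (A (b q)) := by
      rw [inner_conj_symm, hsk]
    have h2 := congrArg Complex.re h1
    simp only [Complex.conj_re, Complex.neg_re] at h2
    apply Complex.ext
    · simp; linarith
    · simp
  have hoff : inner ℂ (b k) (A (b j)) = - (starRingEnd ℂ) (inner ℂ (b j) (A (b k))) := by
    rw [inner_conj_symm, hsk, neg_neg]
  have hother : ∀ p, p ≠ j → p ≠ k → mu p ≠ mu j := by
    intro p h1 h2 h
    rcases (hm1 p).1 h with h | h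
    · exact h1 h
    · exact h2 h
  refine ⟨((inner ℂ (b j) (A (b j))).im + (inner ℂ (b k) (A (b k))).im) / 2,
    fun q => inner ℂ (b q) (A (b q)), ?_, ?_, ?_⟩
  · apply onb_ext b
    intro p
    rw [inner_add_right, inner_smul_right, inner_smul_right, onb_inner, onb_inner]
    by_cases h1 : p = j
    · subst h1
      rw [if_pos rfl, if_neg hjk, hdiag p]
      push_cast
      simp
      ring
    by_cases h2 : p = k
    · subst h2
      rw [if_pos rfl, if_neg h1, hoff]
      generalize inner ℂ (b j) (A (b p)) = z
      apply Complex.ext <;> simp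
    · rw [if_neg h1, if_neg h2, hz p j (hother p h1 h2)]
      simp
  · apply onb_ext b
    intro p
    rw [inner_add_right, inner_smul_right, inner_smul_right, onb_inner, onb_inner]
    by_cases h1 : p = j
    · subst h1
      rw [if_pos rfl, if_neg hjk]
      apply Complex.ext <;> simp
    by_cases h2 : p = k
    · subst h2
      rw [if_pos rfl, if_neg h1, hdiag p]
      push_cast
      simp
      ring
    · rw [if_neg h1, if_neg h2, hz p k (hkj ▸ hother p h1 h2)]
      simp
  · intro q h1 h2
    apply onb_ext b
    intro p
    rw [inner_smul_right, onb_inner]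
    by_cases h : p = q
    · subst h; simp
    · rw [if_neg h, hz p q (fun h' => h (hm2 q h1 h2 p h')), mul_zero]

theorem cS_combo (e1 e2 : V) (x y z : ℝ) (a1 a2 a3 b1 b2 b3 c1 c2 c3 : ℝ) :
    x • cS e1 e2 a1 a2 a3 + y • cS e1 e2 b1 b2 b3 + z • cS e1 e2 c1 c2 c3 =
      cS e1 e2 (x * a1 + y * b1 + z * c1) (x * a2 + y * b2 + z * c2)
        (x * a3 + y * b3 + z * c3) := by
  simp only [cS]
  module

/-- two non-parallel block elements generate the whole `su(2)` -/
theorem cS_mem_of {L : Submodule ℝ (V →L[ℂ] V)} (hL : ∀ A ∈ L, ∀ B ∈ L, B * A - A * B ∈ L)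
    {b : OrthonormalBasis (Fin n) ℂ V} {j k : Fin n} (hjk : j ≠ k)
    {A B : V →L[ℂ] V} {a1 a2 a3 b1 b2 b3 : ℝ} (hA : BlkForm b j k A a1 a2 a3)
    (hB : BlkForm b j k B b1 b2 b3) (hAL : A ∈ L) (hBL : B ∈ L)
    (hc : (a2 * b3 - a3 * b2) ^ 2 + (a3 * b1 - a1 * b3) ^ 2 + (a1 * b2 - a2 * b1) ^ 2 ≠ 0)
    (w1 w2 w3 : ℝ) : cS (b j) (b k) w1 w2 w3 ∈ L := by
  have m1 := hL _ hBL _ hAL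
  rw [hA.bracket hjk hB] at m1
  have m2 := hL _ m1 _ hAL
  rw [hA.bracket hjk (cS_form b hjk _ _ _)] at m2
  have m3 := hL _ m1 _ hBL
  rw [hB.bracket hjk (cS_form b hjk _ _ _)] at m3
  set c1 := a2 * b3 - a3 * b2 with hc1
  set c2 := a3 * b1 - a1 * b3 with hc2
  set c3 := a1 * b2 - a2 * b1 with hc3
  set N := c1 ^ 2 + c2 ^ 2 + c3 ^ 2 with hN
  have key := L.add_mem (L.add_mem
    (L.smul_mem ((w1 * c1 + w2 * c2 + w3 * c3) / (2 * N)) m1)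
    (L.smul_mem (-(w1 * b1 + w2 * b2 + w3 * b3) / (4 * N)) m2))
    (L.smul_mem ((w1 * a1 + w2 * a2 + w3 * a3) / (4 * N)) m3)
  rw [cS_combo] at key
  convert key using 1
  congr 1
  · field_simp
    rw [hN, hc1, hc2, hc3]; ring
  · field_simp
    rw [hN, hc1, hc2, hc3]; ring
  · field_simp
    rw [hN, hc1, hc2, hc3]; ring

variable {U : Set (EuclideanSpace ℝ (Fin m))} {T : EuclideanSpace ℝ (Fin m) → V →L[ℂ] V}
  {D : EuclideanSpace ℝ (Fin m) →ₗ[ℝ] (V →L[ℂ] V)} {lam : EuclideanSpace ℝ (Fin m) → Fin n → ℝ}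

theorem cross_zero {a1 a2 a3 b1 b2 b3 : ℝ}
    (h : (a2 * b3 - a3 * b2) ^ 2 + (a3 * b1 - a1 * b3) ^ 2 + (a1 * b2 - a2 * b1) ^ 2 = 0) :
    ∃ s t : ℝ, (s ≠ 0 ∨ t ≠ 0) ∧ s * a1 + t * b1 = 0 ∧ s * a2 + t * b2 = 0 ∧
      s * a3 + t * b3 = 0 := by
  have h1 : a2 * b3 - a3 * b2 = 0 := by
    have := sq_nonneg (a2 * b3 - a3 * b2); have := sq_nonneg (a3 * b1 - a1 * b3)
    have := sq_nonneg (a1 * b2 - a2 * b1)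
    exact pow_eq_zero_iff (two_ne_zero) |>.1 (by linarith)
  have h2 : a3 * b1 - a1 * b3 = 0 := by
    have := sq_nonneg (a2 * b3 - a3 * b2); have := sq_nonneg (a3 * b1 - a1 * b3)
    have := sq_nonneg (a1 * b2 - a2 * b1)
    exact pow_eq_zero_iff (two_ne_zero) |>.1 (by linarith)
  have h3 : a1 * b2 - a2 * b1 = 0 := by
    have := sq_nonneg (a2 * b3 - a3 * b2); have := sq_nonneg (a3 * b1 - a1 * b3)
    have := sq_nonneg (a1 * b2 - a2 * b1)
    exact pow_eq_zero_iff (two_ne_zero) |>.1 (by linarith)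
  by_cases x1 : a1 = 0
  · by_cases x2 : a2 = 0
    · by_cases x3 : a3 = 0
      · exact ⟨1, 0, Or.inl one_ne_zero, by simp [x1], by simp [x2], by simp [x3]⟩
      · exact ⟨-b3, a3, Or.inr x3, by linarith, by linarith, by ring⟩
    · exact ⟨-b2, a2, Or.inr x2, by linarith, by ring, by linarith⟩
  · exact ⟨-b1, a1, Or.inr x1, by ring, by linarith, by linarith⟩

theorem SpecFam.su (F : SpecFam U T D lam) (hm : 2 ≤ m) (hn : 2 ≤ n)
    (hcc : ConicallyConnected U lam) (L : Submodule ℝ (V →L[ℂ] V))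
    (hS : ∀ u ∈ U, (-Complex.I) • T u ∈ L) (hsk : ∀ A ∈ L, IsSkew A)
    (hL : ∀ A ∈ L, ∀ B ∈ L, B * A - A * B ∈ L) :
    ∃ e1 e2 : V, ‖e1‖ = 1 ∧ ‖e2‖ = 1 ∧ inner ℂ e1 e2 = 0 ∧
      cS1 e1 e2 ∈ L ∧ cS2 e1 e2 ∈ L ∧ cS3 e1 e2 ∈ L := by
  obtain ⟨j, k, hjk'⟩ : ∃ j k : Fin n, (j : ℕ) + 1 = k := ⟨⟨0, by omega⟩, ⟨1, by omega⟩, rfl⟩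
  have hjk : j ≠ k := by rintro rfl; omega
  obtain ⟨u, hcon, hsimp⟩ := hcc.2 j k hjk'
  have hu : u ∈ U := hcon.1
  obtain ⟨hmono, b, hb⟩ := F.spec u hu
  have hD : ∀ v, (-Complex.I) • D v ∈ L := by
    intro v
    obtain ⟨ε, hε, hU⟩ := open_ray F.op hu v
    have h2 := L.sub_mem (hS _ (hU (ε / 2) (by linarith) (by linarith))) (hS u hu)
    rw [F.aff, smul_add, add_sub_cancel_left, smul_comm, Complex.coe_smul] at h2
    have h3 := L.smul_mem (ε / 2)⁻¹ h2
    rwa [smul_smul, inv_mul_cancel₀ (by positivity), one_smul] at h3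
  have hXb : ∀ l, ((-Complex.I) • T u) (b l) = (-Complex.I * (lam u l : ℂ)) • b l := by
    intro l; rw [smul_apply, hb l, smul_smul]
  have hform : ∀ v, ∃ A ∈ L, BlkForm b j k A (inner ℂ (b j) (D v (b k))).im
      (-(inner ℂ (b j) (D v (b k))).re)
      ((-(inner ℂ (b j) (D v (b j))).re + (inner ℂ (b k) (D v (b k))).re) / 2) := by
    intro v
    obtain ⟨A, hA, hz, he⟩ := block_part hL (hS u hu) (hsk _ (hS u hu)) hXb (hD v)
    refine ⟨A, hA, ?_⟩
    have := BlkForm.of_zeros hjk (hsk A hA) hz hcon.2.2.1 (fun l h1 h2 => hsimp l h1 h2)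
    rw [he j k hcon.2.1, he j j rfl, he k k rfl] at this
    simpa [inner_smul_right, neg_add_eq_sub, sub_eq_add_neg] using this
  let v : EuclideanSpace ℝ (Fin m) := EuclideanSpace.single ⟨0, by omega⟩ 1
  let w : EuclideanSpace ℝ (Fin m) := EuclideanSpace.single ⟨1, by omega⟩ 1
  obtain ⟨A, hA, fA⟩ := hform v
  obtain ⟨B, hB, fB⟩ := hform w
  have hne := cS_mem_of hL hjk fA fB hA hB (by
    intro h0
    obtain ⟨s, t, hst, z1, z2, z3⟩ := cross_zero h0
    have hx : s • v + t • w ≠ 0 := by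
      intro h
      have e0 := congrArg (fun x : EuclideanSpace ℝ (Fin m) => x ⟨0, by omega⟩) h
      have e1 := congrArg (fun x : EuclideanSpace ℝ (Fin m) => x ⟨1, by omega⟩) h
      simp [v, w] at e0 e1
      rcases hst with h | h
      · exact h e0
      · exact h e1
    have hDx : ∀ x, D (s • v + t • w) x = (s : ℂ) • D v x + (t : ℂ) • D w x := by
      intro x; rw [map_add, map_smul, map_smul]; simp
    have hself : ∀ q y, (inner ℂ (b q) (D y (b q))).im = 0 := by
      intro q y
      have h1 : (starRingEnd ℂ) (inner ℂ (b q) (D y (b q))) = inner ℂ (b q) (D y (b q)) := by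
        rw [inner_conj_symm, F.symD]
      exact Complex.conj_eq_iff_im.1 h1
    refine F.conical_dir hcon hx (hb j) (by rw [hb k, hcon.2.1]) (b.norm_eq_one j)
      (b.norm_eq_one k) (by rw [onb_inner, if_neg hjk]) ?_ ?_
    · rw [hDx, inner_add_right, inner_smul_right, inner_smul_right]
      apply Complex.ext
      · simp; linarith
      · simp; linarith
    · rw [hDx, hDx, inner_add_right, inner_smul_right, inner_smul_right, inner_add_right,
        inner_smul_right, inner_smul_right]
      apply Complex.ext
      · simp; linarith
      · simp [hself])
  refine ⟨b j, b k, b.norm_eq_one j, b.norm_eq_one k, by rw [onb_inner, if_neg hjk], ?_, ?_, ?_⟩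
  · simpa [cS] using hne 1 0 0
  · simpa [cS] using hne 0 1 0
  · simpa [cS] using hne 0 0 1

end PartC6

section PartD

variable {n m : ℕ}

/-- the Hamiltonian as an operator -/
noncomputable def hamT (H0 : Matrix (Fin n) (Fin n) ℂ) (Hc : Fin m → Matrix (Fin n) (Fin n) ℂ)
    (u : EuclideanSpace ℝ (Fin m)) :
    EuclideanSpace ℂ (Fin n) →L[ℂ] EuclideanSpace ℂ (Fin n) :=
  Matrix.toEuclideanCLM (𝕜 := ℂ) (controlHam H0 Hc u)

/-- the derivative of the Hamiltonian as an operator -/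
noncomputable def hamD (Hc : Fin m → Matrix (Fin n) (Fin n) ℂ) :
    EuclideanSpace ℝ (Fin m) →ₗ[ℝ]
      (EuclideanSpace ℂ (Fin n) →L[ℂ] EuclideanSpace ℂ (Fin n)) :=
  { toFun := fun v => ∑ i, (v i : ℂ) • Matrix.toEuclideanCLM (𝕜 := ℂ) (Hc i)
    map_add' := by
      intro x y
      ext z
      simp [add_mul, Finset.sum_add_distrib]
    map_smul' := by
      intro r x
      ext z
      simp [Finset.mul_sum, mul_assoc] }

theorem hamT_eq (H0 : Matrix (Fin n) (Fin n) ℂ) (Hc : Fin m → Matrix (Fin n) (Fin n) ℂ)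
    (u : EuclideanSpace ℝ (Fin m)) :
    hamT H0 Hc u = Matrix.toEuclideanCLM (𝕜 := ℂ) H0 + hamD Hc u := by
  have : ∀ (r : ℂ) (M : Matrix (Fin n) (Fin n) ℂ), Matrix.toEuclideanCLM (𝕜 := ℂ) (r • M) =
      r • Matrix.toEuclideanCLM (𝕜 := ℂ) M := fun r M => map_smul _ r M
  simp only [hamT, controlHam, hamD, map_add, map_sum, this]
  rfl

theorem herm_inner {M : Matrix (Fin n) (Fin n) ℂ} (hM : M.IsHermitian)
    (x y : EuclideanSpace ℂ (Fin n)) :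
    inner ℂ (Matrix.toEuclideanCLM (𝕜 := ℂ) M x) y =
      inner ℂ x (Matrix.toEuclideanCLM (𝕜 := ℂ) M y) := by
  have := Matrix.isSymmetric_toEuclideanLin_iff.2 hM
  exact this x y

theorem exists_perm_of_map_eq {f g : Fin n → ℂ}
    (h : Multiset.map f Finset.univ.val = Multiset.map g Finset.univ.val) :
    ∃ σ : Fin n ≃ Fin n, ∀ i, g (σ i) = f i := by
  have hcard : ∀ c, Fintype.card {x // f x = c} = Fintype.card {x // g x = c} := by
    intro c
    have := congrArg (Multiset.count c) h
    rw [Multiset.count_map, Multiset.count_map] at this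
    rw [Fintype.card_subtype, Fintype.card_subtype, Finset.card_def, Finset.card_def,
      Finset.filter_val, Finset.filter_val]
    simpa [eq_comm] using this
  let e : ∀ c, {x // f x = c} ≃ {x // g x = c} := fun c => Fintype.equivOfCardEq (hcard c)
  refine ⟨(Equiv.sigmaFiberEquiv f).symm.trans
    ((Equiv.sigmaCongrRight e).trans (Equiv.sigmaFiberEquiv g)), fun i => ?_⟩
  exact (e (f i) ⟨i, rfl⟩).2

theorem diag_of_charpoly {M : Matrix (Fin n) (Fin n) ℂ} (hM : M.IsHermitian) {mu : Fin n → ℝ}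
    (h : M.charpoly = ∏ j, (Polynomial.X - Polynomial.C ((mu j : ℂ)))) :
    ∃ b : OrthonormalBasis (Fin n) ℂ (EuclideanSpace ℂ (Fin n)),
      DiagBy (Matrix.toEuclideanCLM (𝕜 := ℂ) M) b mu := by
  have h1 : Multiset.map (fun j => (mu j : ℂ)) Finset.univ.val =
      Multiset.map (fun j => (hM.eigenvalues j : ℂ)) Finset.univ.val := by
    have e1 := hM.roots_charpoly_eq_eigenvalues
    rw [h, Polynomial.roots_prod _ _ (by
      simp [Finset.prod_ne_zero_iff, Polynomial.X_sub_C_ne_zero])] at e1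
    simpa [Function.comp_def] using e1
  obtain ⟨σ, hσ⟩ := exists_perm_of_map_eq h1
  refine ⟨hM.eigenvectorBasis.reindex σ.symm, fun l => ?_⟩
  rw [OrthonormalBasis.reindex_apply, Equiv.symm_symm, ← hσ l]
  have := hM.mulVec_eigenvectorBasis (σ l)
  apply (WithLp.ofLp_injective 2)
  rw [Matrix.ofLp_toEuclideanCLM, this]
  ext i
  simp

theorem ham_specFam {U : Set (EuclideanSpace ℝ (Fin m))} (hUopen : IsOpen U)
    {H0 : Matrix (Fin n) (Fin n) ℂ} {Hc : Fin m → Matrix (Fin n) (Fin n) ℂ}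
    (hH0 : H0.IsHermitian) (hHc : ∀ i, (Hc i).IsHermitian)
    {lam : EuclideanSpace ℝ (Fin m) → Fin n → ℝ} (hlam : IsOrderedSpectrum H0 Hc U lam) :
    SpecFam U (hamT H0 Hc) (hamD Hc) lam := by
  have hD : ∀ u x y, inner ℂ (hamD Hc u x) y = inner ℂ x (hamD Hc u y) := by
    intro u x y
    have e : ∀ z, hamD Hc u z = ∑ i, (u i : ℂ) • (Matrix.toEuclideanCLM (𝕜 := ℂ) (Hc i) z) := by
      intro z
      simp only [hamD, LinearMap.coe_mk, AddHom.coe_mk, sum_apply, smul_apply]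
    rw [e, e, sum_inner, inner_sum]
    refine Finset.sum_congr rfl fun i _ => ?_
    rw [inner_smul_left, inner_smul_right, herm_inner (hHc i), Complex.conj_ofReal]
  have hherm : ∀ u, (controlHam H0 Hc u).IsHermitian := by
    intro u
    unfold controlHam
    refine hH0.add ?_
    unfold Matrix.IsHermitian
    rw [Matrix.conjTranspose_sum]
    refine Finset.sum_congr rfl fun i _ => ?_
    rw [Matrix.conjTranspose_smul, (hHc i).eq]
    simp
  refine ⟨hUopen, ?_, ?_, hD, ?_, ?_⟩
  · intro u v t
    rw [hamT_eq, hamT_eq, map_add, map_smul, Complex.coe_smul, add_assoc]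
  · intro u x y
    exact herm_inner (hherm u) x y
  · have : hamT H0 Hc = fun u => Matrix.toEuclideanCLM (𝕜 := ℂ) H0 + hamD Hc u :=
      funext (hamT_eq H0 Hc)
    rw [this]
    exact continuous_const.add (hamD Hc).continuous_of_finiteDimensional
  · intro u hu
    exact ⟨(hlam u hu).1, diag_of_charpoly (hherm u) (hlam u hu).2⟩

end PartD

section PartE

variable {n m : ℕ} {U : Set (EuclideanSpace ℝ (Fin m))}
  {H0 : Matrix (Fin n) (Fin n) ℂ} {Hc : Fin m → Matrix (Fin n) (Fin n) ℂ}

theorem reach_refl (hU : U.Nonempty) {ψ0 : EuclideanSpace ℂ (Fin n)} (h0 : ‖ψ0‖ = 1) :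
    ψ0 ∈ sphereReachable U (controlHam H0 Hc) ψ0 := by
  obtain ⟨u0, hu0⟩ := hU
  refine ⟨0, le_rfl, fun _ => u0, fun _ => ψ0, ⟨MeasureTheory.aestronglyMeasurable_const, fun _ _ => hu0,
    ‖u0‖, fun _ _ => le_rfl⟩, ⟨fun _ _ => by simp [h0], by simp, ?_⟩, rfl, rfl⟩
  intro t ht
  have : t = 0 := le_antisymm ht.2 ht.1
  subst this
  simp

theorem reach_step {ψ0 ψ1 : EuclideanSpace ℂ (Fin n)}
    (h : ψ1 ∈ sphereReachable U (controlHam H0 Hc) ψ0) {ub : EuclideanSpace ℝ (Fin m)}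
    (hub : ub ∈ U) (hsk : IsSkew ((-Complex.I) • hamT H0 Hc ub)) {t : ℝ} (ht : 0 ≤ t) :
    cEx t ((-Complex.I) • hamT H0 Hc ub) ψ1 ∈ sphereReachable U (controlHam H0 Hc) ψ0 := by
  obtain ⟨T, hT, u, ψ, ⟨hum, huU, C, hC⟩, ⟨hsph, hIntg, heq⟩, hψ0, hψT⟩ := h
  set X := (-Complex.I) • hamT H0 Hc ub with hX
  set u' : ℝ → EuclideanSpace ℝ (Fin m) := fun s => if s ≤ T then u s else ub with hu'
  set ψ' : ℝ → EuclideanSpace ℂ (Fin n) :=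
    fun s => if s ≤ T then ψ s else cEx (s - T) X ψ1 with hψ'
  have u1 : ∀ s, s ≤ T → u' s = u s := fun s hs => if_pos hs
  have u2 : ∀ s, T < s → u' s = ub := fun s hs => if_neg (not_le.2 hs)
  have p1 : ∀ s, s ≤ T → ψ' s = ψ s := fun s hs => if_pos hs
  have p2 : ∀ s, T < s → ψ' s = cEx (s - T) X ψ1 := fun s hs => if_neg (not_le.2 hs)
  set f : ℝ → EuclideanSpace ℂ (Fin n) := fun s =>
    (-Complex.I) • Matrix.toEuclideanLin (controlHam H0 Hc (u s)) (ψ s) with hf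
  set g : ℝ → EuclideanSpace ℂ (Fin n) := fun s => X (cEx (s - T) X ψ1) with hg
  set F : ℝ → EuclideanSpace ℂ (Fin n) := fun s =>
    (-Complex.I) • Matrix.toEuclideanLin (controlHam H0 Hc (u' s)) (ψ' s) with hF
  have F1 : ∀ s, s ≤ T → F s = f s := fun s hs => by simp only [hF, hf, u1 s hs, p1 s hs]
  have F2 : ∀ s, T < s → F s = g s := fun s hs => by
    simp only [hF, hg, u2 s hs, p2 s hs]; rfl
  have hder : ∀ s, HasDerivAt (fun r => cEx (r - T) X ψ1) (g s) s := by
    intro s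
    have := (cEx_apply_hasDerivAt (s - T) X ψ1).comp_sub_const s T
    exact this
  have hgc : Continuous g := by
    have : Continuous (fun r => cEx (r - T) X ψ1) :=
      continuous_iff_continuousAt.2 fun s => (hder s).continuousAt
    exact X.continuous.comp this
  have hI1 : IntervalIntegrable F MeasureTheory.volume 0 T := by
    refine hIntg.congr_ae ?_
    refine MeasureTheory.ae_restrict_of_forall_mem measurableSet_uIoc fun s hs => ?_
    rw [Set.uIoc_of_le hT] at hs
    exact (F1 s hs.2).symm
  have hI2 : ∀ r, T ≤ r → IntervalIntegrable F MeasureTheory.volume T r := by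
    intro r hr
    refine (hgc.intervalIntegrable T r).congr_ae ?_
    refine MeasureTheory.ae_restrict_of_forall_mem measurableSet_uIoc fun s hs => ?_
    rw [Set.uIoc_of_le hr] at hs
    exact (F2 s hs.1).symm
  have J1 : ∀ r, 0 ≤ r → r ≤ T → ∫ s in (0:ℝ)..r, F s = ∫ s in (0:ℝ)..r, f s := by
    intro r h0 hr
    apply intervalIntegral.integral_congr
    intro s hs
    rw [Set.uIcc_of_le h0] at hs
    exact F1 s (hs.2.trans hr)
  have J2 : ∀ r, T ≤ r → ∫ s in T..r, F s = cEx (r - T) X ψ1 - ψ1 := by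
    intro r hr
    have e1 : ∫ s in T..r, F s = ∫ s in T..r, g s := by
      apply intervalIntegral.integral_congr_ae
      refine Filter.Eventually.of_forall fun s hs => ?_
      rw [Set.uIoc_of_le hr] at hs
      exact F2 s hs.1
    rw [e1, intervalIntegral.integral_eq_sub_of_hasDerivAt (fun s _ => hder s)
      (hgc.intervalIntegrable T r), sub_self, cEx_zero]
    simp
  have hn1 : ‖ψ1‖ = 1 := by
    have := hsph T ⟨hT, le_rfl⟩
    rw [hψT] at this
    simpa using this
  refine ⟨T + t, by linarith, u', ψ', ⟨?_, ?_, max C ‖ub‖, ?_⟩, ⟨?_, ?_, ?_⟩, ?_, ?_⟩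
  · rw [← Set.Icc_union_Ioc_eq_Icc hT (by linarith : T ≤ T + t), aestronglyMeasurable_union_iff]
    constructor
    · refine hum.congr ?_
      exact MeasureTheory.ae_restrict_of_forall_mem measurableSet_Icc
        fun s hs => (u1 s hs.2).symm
    · refine (MeasureTheory.aestronglyMeasurable_const (b := ub)).congr ?_
      exact MeasureTheory.ae_restrict_of_forall_mem measurableSet_Ioc
        fun s hs => (u2 s hs.1).symm
  · intro s hs
    rcases le_or_gt s T with h | h
    · rw [u1 s h]; exact huU s ⟨hs.1, h⟩
    · rw [u2 s h]; exact hub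
  · intro s hs
    rcases le_or_gt s T with h | h
    · rw [u1 s h]; exact (hC s ⟨hs.1, h⟩).trans (le_max_left _ _)
    · rw [u2 s h]; exact le_max_right _ _
  · intro s hs
    rcases le_or_gt s T with h | h
    · rw [p1 s h]; exact hsph s ⟨hs.1, h⟩
    · rw [p2 s h]; simp [cEx_norm hsk, hn1]
  · exact hI1.trans (hI2 _ (by linarith))
  · intro s hs
    rw [p1 0 hT]
    rcases le_or_gt s T with h | h
    · rw [p1 s h, heq s ⟨hs.1, h⟩]
      congr 1
      exact (J1 s hs.1 h).symm
    · rw [p2 s h]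
      change _ = ψ 0 + ∫ s in (0:ℝ)..s, F s
      rw [← intervalIntegral.integral_add_adjacent_intervals hI1 (hI2 s h.le), J2 s h.le,
        J1 T hT le_rfl, ← add_assoc]
      have := heq T ⟨hT, le_rfl⟩
      rw [← this, hψT]
      abel
  · rw [p1 0 hT, hψ0]
  · rcases ht.eq_or_lt with h | h
    · rw [← h, add_zero, p1 T le_rfl, hψT, cEx_zero]; simp
    · rw [p2 (T + t) (by linarith), add_sub_cancel_left]

theorem reach_of_orb (hU : U.Nonempty) {ψ0 ψ1 : EuclideanSpace ℂ (Fin n)} (h0 : ‖ψ0‖ = 1)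
    (hsk : ∀ u ∈ U, IsSkew ((-Complex.I) • hamT H0 Hc u))
    (h : COrb {X | ∃ u ∈ U, X = (-Complex.I) • hamT H0 Hc u} ψ0 ψ1) :
    ψ1 ∈ sphereReachable U (controlHam H0 Hc) ψ0 := by
  induction h with
  | refl => exact reach_refl hU h0
  | step X t hX ht _ ih =>
    obtain ⟨u, hu, rfl⟩ := hX
    exact reach_step ih hu (hsk u hu) ht.le

theorem exact_control {n m : ℕ} (hn : 2 ≤ n)
    (hm : 2 ≤ m)
    (U : Set (EuclideanSpace ℝ (Fin m))) (hUopen : IsOpen U) (hUconn : IsConnected U)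
    (H0 : Matrix (Fin n) (Fin n) ℂ) (Hc : Fin m → Matrix (Fin n) (Fin n) ℂ)
    (hH0 : H0.IsHermitian) (hHc : ∀ i, (Hc i).IsHermitian)
    (lam : EuclideanSpace ℝ (Fin m) → Fin n → ℝ)
    (hlam : IsOrderedSpectrum H0 Hc U lam)
    (hcc : ConicallyConnected U lam) :
    ∀ ψ0 ∈ Metric.sphere (0 : EuclideanSpace ℂ (Fin n)) 1,
      sphereReachable U (controlHam H0 Hc) ψ0 =
        Metric.sphere (0 : EuclideanSpace ℂ (Fin n)) 1 := by
  intro ψ0 h0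
  have F := ham_specFam hUopen hH0 hHc hlam
  have hsk : ∀ u ∈ U, IsSkew ((-Complex.I) • hamT H0 Hc u) := by
    intro u _ x y
    rw [smul_apply, smul_apply, inner_smul_left, inner_smul_right, F.symT]
    simp
  have hskS : ∀ X ∈ {X | ∃ u ∈ U, X = (-Complex.I) • hamT H0 Hc u}, IsSkew X := by
    rintro _ ⟨u, hu, rfl⟩
    exact hsk u hu
  have hR : CRank {X | ∃ u ∈ U, X = (-Complex.I) • hamT H0 Hc u} := by
    refine crank_of hskS ?_ ?_
    · intro W hW hbot
      refine F.irr hm hUconn hcc W ?_ hbot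
      intro u hu w hw
      have h1 := hW _ ⟨u, hu, rfl⟩ w hw
      have h2 := W.smul_mem Complex.I h1
      rw [smul_apply, smul_smul] at h2
      simpa using h2
    · intro L hS hLs hL
      exact F.su hm hn hcc L (fun u hu => hS _ ⟨u, hu, rfl⟩) hLs hL
  have h0' : ‖ψ0‖ = 1 := by simpa using h0
  ext ψ1
  constructor
  · rintro ⟨T, hT, u, ψ, _, ⟨hs, _⟩, _, rfl⟩
    exact hs T ⟨hT, le_rfl⟩
  · intro h1
    have h1' : ‖ψ1‖ = 1 := by simpa using h1
    exact reach_of_orb hUconn.nonempty h0' hsk (COrb.exact hskS hR h0' h1')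

end PartE

/-- from Theorem 2.8 of the paper. If the spectrum of the
control-affine Hamiltonian `H(·)` is conically connected, then the system
`i·ψ̇ = H(u)·ψ` is exactly controllable on the unit sphere of `ℂ^n`. -/
theorem conically_connected_exact_controllability_sphere {n m : ℕ} (hn : 2 ≤ n)
    (hm : 2 ≤ m)
    (U : Set (EuclideanSpace ℝ (Fin m))) (hUopen : IsOpen U) (hUconn : IsConnected U)
    (H0 : Matrix (Fin n) (Fin n) ℂ) (Hc : Fin m → Matrix (Fin n) (Fin n) ℂ)
    (hH0 : H0.IsHermitian) (hHc : ∀ i, (Hc i).IsHermitian)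
    (lam : EuclideanSpace ℝ (Fin m) → Fin n → ℝ)
    (hlam : IsOrderedSpectrum H0 Hc U lam)
    (hcc : ConicallyConnected U lam) :
    ∀ ψ0 ∈ Metric.sphere (0 : EuclideanSpace ℂ (Fin n)) 1,
      sphereReachable U (controlHam H0 Hc) ψ0 =
        Metric.sphere (0 : EuclideanSpace ℂ (Fin n)) 1 := by
  exact exact_control hn hm U hUopen hUconn H0 Hc hH0 hHc lam hlam hcc
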